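/- arXiv:2011.09691 — 7 statements merged into one kernel-verified Lean document; each statement's English description precedes it below -/
import Mathlib

section
/- For every nonnegative integer m, (1/m!) ∫_{1}^{∞} {x} (log x)^m / x² dx = 1 − ∑_{k=0}^{m} γ_k / k!; equivalently ℓ_0^{(m)} = −1 + ∑_{k=0}^{m} γ_k / k! equals −(1/m!) ∫_{1}^{∞} {x} (log x)^m / x² dx. -/
open Filter Finset MeasureTheory

/-- The Stieltjes constants `γ_n`. -/
noncomputable def stieltjes (n : ℕ) : ℝ :=
  limUnder atTop (fun N : ℕ =>
    (∑ k ∈ Finset.range N, Real.log ((k : ℝ) + 1) ^ n / ((k : ℝ) + 1)) -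
      Real.log (N : ℝ) ^ (n + 1) / ((n : ℝ) + 1))
/-- The coefficients `ℓ_n^{(m)} = -δ_{n,0} + ∑_{k=0}^n C(n,k) (-1)^{n-k} ∑_{j=0}^{m+k} γ_j/j!`. -/
noncomputable def ellGen (n m : ℕ) : ℝ :=
  -(if n = 0 then (1 : ℝ) else 0) + ∑ k ∈ Finset.range (n + 1),
    (n.choose k : ℝ) * (-1 : ℝ) ^ (n - k) *
      ∑ j ∈ Finset.range (m + k + 1), stieltjes j / (Nat.factorial j : ℝ)

/-- The weight `log^m x / (m! x²)`. -/
noncomputable def logWeight (m : ℕ) (x : ℝ) : ℝ :=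
  Real.log x ^ m / (m.factorial : ℝ) / x ^ 2

/-- The antiderivative `-∑_{j ≤ m} log^j x / (j! x)` of `logWeight m`. -/
noncomputable def logPrimitive (m : ℕ) (x : ℝ) : ℝ :=
  -∑ j ∈ Finset.range (m + 1), Real.log x ^ j / (j.factorial : ℝ) / x

/-- The sequence whose limit is the Stieltjes constant `γ_n`. -/
noncomputable def stieltjesSeq (n N : ℕ) : ℝ :=
  (∑ k ∈ Finset.range N, Real.log ((k : ℝ) + 1) ^ n / ((k : ℝ) + 1)) -
    Real.log (N : ℝ) ^ (n + 1) / ((n : ℝ) + 1)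

lemma hasDerivAt_log_pow_succ (n : ℕ) {x : ℝ} (hx : 0 < x) :
    HasDerivAt (fun y => Real.log y ^ (n + 1) / ((n + 1).factorial : ℝ))
      (Real.log x ^ n / (n.factorial : ℝ) / x) x := by
  have h := ((Real.hasDerivAt_log hx.ne').pow (n + 1)).div_const ((n + 1).factorial : ℝ)
  refine h.congr_deriv ?_
  have hn : (n.factorial : ℝ) ≠ 0 := by positivity
  rw [Nat.factorial_succ]
  push_cast
  field_simp

lemma hasDerivAt_logPrimitive (m : ℕ) {x : ℝ} (hx : 0 < x) :
    HasDerivAt (logPrimitive m) (logWeight m x) x := by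
  induction m with
  | zero =>
    have h := (hasDerivAt_inv hx.ne').neg
    have e : logPrimitive 0 = -(fun y : ℝ => y⁻¹) := by
      funext y; simp [logPrimitive]
    rw [e]
    refine h.congr_deriv ?_
    simp [logWeight]
  | succ m ih =>
    have h := ih.sub ((hasDerivAt_log_pow_succ m hx).div (hasDerivAt_id x) hx.ne')
    have e : logPrimitive (m + 1) = logPrimitive m -
        ((fun y => Real.log y ^ (m + 1) / ((m + 1).factorial : ℝ)) / id) := by
      funext y
      simp only [logPrimitive, Finset.sum_range_succ _ (m + 1), Pi.sub_apply, Pi.div_apply, id]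
      ring
    rw [e]
    refine h.congr_deriv ?_
    simp only [logWeight, id]
    field_simp
    ring

lemma logWeight_nonneg (m : ℕ) {x : ℝ} (hx : 1 ≤ x) : 0 ≤ logWeight m x := by
  have := Real.log_nonneg hx
  unfold logWeight
  positivity

lemma tendsto_logPrimitive (m : ℕ) : Tendsto (logPrimitive m) atTop (nhds 0) := by
  have h : ∀ j ∈ Finset.range (m + 1),
      Tendsto (fun x : ℝ => Real.log x ^ j / (j.factorial : ℝ) / x) atTop (nhds 0) := by
    intro j _
    have h := ((Real.isLittleO_pow_log_id_atTop (n := j)).tendsto_div_nhds_zero).div_const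
      (j.factorial : ℝ)
    rw [zero_div] at h
    refine h.congr fun x => ?_
    simp only [id]
    exact div_right_comm _ _ _
  have hs := (tendsto_finsetSum _ h).neg
  rw [Finset.sum_const_zero, neg_zero] at hs
  exact hs

lemma integrableOn_logWeight (m : ℕ) : IntegrableOn (logWeight m) (Set.Ioi 1) := by
  refine integrableOn_Ioi_deriv_of_nonneg
    (hasDerivAt_logPrimitive m one_pos).continuousAt.continuousWithinAt
    (fun x hx => hasDerivAt_logPrimitive m (one_pos.trans hx))
    (fun x hx => logWeight_nonneg m (le_of_lt hx)) (tendsto_logPrimitive m)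

lemma integrableOn_fract_mul_logWeight (m : ℕ) :
    IntegrableOn (fun x => Int.fract x * logWeight m x) (Set.Ioi 1) := by
  refine (integrableOn_logWeight m).bdd_mul (c := 1) measurable_fract.aestronglyMeasurable
    (Eventually.of_forall fun x => ?_)
  rw [Real.norm_eq_abs, Int.abs_fract]
  exact (Int.fract_lt_one x).le

lemma integral_fract_mul_logWeight_unit (m N : ℕ) :
    ∫ x in ((N : ℝ) + 1)..((N : ℝ) + 1 + 1), Int.fract x * logWeight m x =
      (Real.log ((N : ℝ) + 1 + 1) ^ (m + 1) / ((m + 1).factorial : ℝ) -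
          ((N : ℝ) + 1) * logPrimitive m ((N : ℝ) + 1 + 1)) -
        (Real.log ((N : ℝ) + 1) ^ (m + 1) / ((m + 1).factorial : ℝ) -
          ((N : ℝ) + 1) * logPrimitive m ((N : ℝ) + 1)) := by
  have hle : (N : ℝ) + 1 ≤ (N : ℝ) + 1 + 1 := by linarith
  have hpos : ∀ x ∈ Set.uIcc ((N : ℝ) + 1) ((N : ℝ) + 1 + 1), 0 < x := by
    intro x hx
    rw [Set.uIcc_of_le hle] at hx
    exact lt_of_lt_of_le (by positivity) hx.1
  have hcongr : ∫ x in ((N : ℝ) + 1)..((N : ℝ) + 1 + 1), Int.fract x * logWeight m x =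
      ∫ x in ((N : ℝ) + 1)..((N : ℝ) + 1 + 1),
        (Real.log x ^ m / (m.factorial : ℝ) / x - ((N : ℝ) + 1) * logWeight m x) := by
    rw [intervalIntegral.integral_of_le hle, intervalIntegral.integral_of_le hle,
      integral_Ioc_eq_integral_Ioo, integral_Ioc_eq_integral_Ioo]
    refine setIntegral_congr_fun measurableSet_Ioo fun x hx => ?_
    have hx0 : x ≠ 0 := (lt_trans (by positivity) hx.1).ne'
    have hf : Int.fract x = x - ((N : ℝ) + 1) := by
      rw [Int.fract_eq_iff]
      exact ⟨by linarith [hx.1], by linarith [hx.2], (N : ℤ) + 1, by push_cast; ring⟩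
    simp only [hf, logWeight]
    field_simp
  rw [hcongr]
  refine intervalIntegral.integral_eq_sub_of_hasDerivAt
    (f := fun x => Real.log x ^ (m + 1) / ((m + 1).factorial : ℝ) -
      ((N : ℝ) + 1) * logPrimitive m x)
    (fun x hx => (hasDerivAt_log_pow_succ m (hpos x hx)).sub
      ((hasDerivAt_logPrimitive m (hpos x hx)).const_mul _)) ?_
  refine ContinuousOn.intervalIntegrable ?_
  have hlog : ContinuousOn Real.log (Set.uIcc ((N : ℝ) + 1) ((N : ℝ) + 1 + 1)) :=
    Real.continuousOn_log.mono fun x hx => (hpos x hx).ne'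
  unfold logWeight
  exact (((hlog.pow m).div_const _).div continuousOn_id fun x hx => (hpos x hx).ne').sub
    (continuousOn_const.mul (((hlog.pow m).div_const _).div (continuousOn_id.pow 2)
      fun x hx => pow_ne_zero 2 (hpos x hx).ne'))

lemma intervalIntegrable_fract_mul_logWeight (m : ℕ) {a b : ℝ} (ha : 1 ≤ a) (hab : a ≤ b) :
    IntervalIntegrable (fun x => Int.fract x * logWeight m x) volume a b := by
  rw [intervalIntegrable_iff_integrableOn_Ioc_of_le hab]
  exact (integrableOn_fract_mul_logWeight m).mono_set fun x hx => lt_of_le_of_lt ha hx.1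

lemma integral_fract_mul_logWeight_eq_logPrimitive (m N : ℕ) :
    ∫ x in (1 : ℝ)..((N : ℝ) + 1), Int.fract x * logWeight m x =
      Real.log ((N : ℝ) + 1) ^ (m + 1) / ((m + 1).factorial : ℝ) -
        ((N : ℝ) + 1) * logPrimitive m ((N : ℝ) + 1) +
        ∑ k ∈ Finset.range (N + 1), logPrimitive m ((k : ℝ) + 1) := by
  induction N with
  | zero => simp
  | succ N ih =>
    have hN : (0 : ℝ) ≤ N := Nat.cast_nonneg N
    push_cast
    rw [← intervalIntegral.integral_add_adjacent_intervals
      (b := (N : ℝ) + 1) (intervalIntegrable_fract_mul_logWeight m le_rfl (by linarith))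
      (intervalIntegrable_fract_mul_logWeight m (by linarith) (by linarith)),
      ih, integral_fract_mul_logWeight_unit, Finset.sum_range_succ _ (N + 1)]
    push_cast
    ring

lemma integral_fract_mul_logWeight_eq_stieltjesSeq (m N : ℕ) :
    ∫ x in (1 : ℝ)..((N : ℝ) + 1), Int.fract x * logWeight m x =
      1 - ∑ j ∈ Finset.range (m + 1), stieltjesSeq j (N + 1) / (j.factorial : ℝ) := by
  rw [integral_fract_mul_logWeight_eq_logPrimitive]
  have hN : (N : ℝ) + 1 ≠ 0 := by positivity
  have h1 : -(((N : ℝ) + 1) * logPrimitive m ((N : ℝ) + 1)) =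
      ∑ j ∈ Finset.range (m + 1), Real.log ((N : ℝ) + 1) ^ j / (j.factorial : ℝ) := by
    rw [logPrimitive, mul_neg, neg_neg, Finset.mul_sum]
    refine Finset.sum_congr rfl fun j _ => ?_
    field_simp
  have h2 : Real.log ((N : ℝ) + 1) ^ (m + 1) / ((m + 1).factorial : ℝ) +
      ∑ j ∈ Finset.range (m + 1), Real.log ((N : ℝ) + 1) ^ j / (j.factorial : ℝ) =
      1 + ∑ j ∈ Finset.range (m + 1),
        Real.log ((N : ℝ) + 1) ^ (j + 1) / ((j + 1).factorial : ℝ) := by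
    rw [add_comm, ← Finset.sum_range_succ
      (fun j => Real.log ((N : ℝ) + 1) ^ j / (j.factorial : ℝ)), Finset.sum_range_succ']
    simp [add_comm]
  have h3 : ∑ k ∈ Finset.range (N + 1), logPrimitive m ((k : ℝ) + 1) =
      -∑ j ∈ Finset.range (m + 1), ∑ k ∈ Finset.range (N + 1),
        Real.log ((k : ℝ) + 1) ^ j / (j.factorial : ℝ) / ((k : ℝ) + 1) := by
    rw [Finset.sum_comm]
    simp [logPrimitive]
  have h4 : ∑ j ∈ Finset.range (m + 1), stieltjesSeq j (N + 1) / (j.factorial : ℝ) =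
      (∑ j ∈ Finset.range (m + 1), ∑ k ∈ Finset.range (N + 1),
        Real.log ((k : ℝ) + 1) ^ j / (j.factorial : ℝ) / ((k : ℝ) + 1)) -
      ∑ j ∈ Finset.range (m + 1),
        Real.log ((N : ℝ) + 1) ^ (j + 1) / ((j + 1).factorial : ℝ) := by
    rw [← Finset.sum_sub_distrib]
    refine Finset.sum_congr rfl fun j _ => ?_
    rw [stieltjesSeq, sub_div, Finset.sum_div]
    congr 1
    · exact Finset.sum_congr rfl fun k _ => div_right_comm _ _ _
    · rw [Nat.factorial_succ]
      push_cast
      rw [div_div]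
  rw [h3, h4]
  linarith

lemma tendsto_sum_stieltjesSeq (m : ℕ) :
    Tendsto (fun N => ∑ j ∈ Finset.range (m + 1), stieltjesSeq j N / (j.factorial : ℝ)) atTop
      (nhds (1 - ∫ x in Set.Ioi (1 : ℝ), Int.fract x * logWeight m x)) := by
  rw [← tendsto_add_atTop_iff_nat 1]
  have h := intervalIntegral_tendsto_integral_Ioi (1 : ℝ) (integrableOn_fract_mul_logWeight m)
    (tendsto_atTop_add_const_right atTop (1 : ℝ) tendsto_natCast_atTop_atTop)
  refine (h.const_sub 1).congr fun N => ?_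
  rw [integral_fract_mul_logWeight_eq_stieltjesSeq]
  ring

lemma tendsto_stieltjesSeq (n : ℕ) :
    Tendsto (stieltjesSeq n) atTop (nhds (stieltjes n)) := by
  suffices h : ∃ c, Tendsto (fun N => stieltjesSeq n N / (n.factorial : ℝ)) atTop (nhds c) by
    obtain ⟨c, hc⟩ := h
    refine tendsto_nhds_limUnder ⟨c * n.factorial, (hc.mul_const _).congr fun N => ?_⟩
    exact div_mul_cancel₀ _ (by positivity)
  cases n with
  | zero => exact ⟨_, by simpa using tendsto_sum_stieltjesSeq 0⟩
  | succ n =>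
    refine ⟨_, ((tendsto_sum_stieltjesSeq (n + 1)).sub (tendsto_sum_stieltjesSeq n)).congr
      fun N => ?_⟩
    rw [Finset.sum_range_succ _ (n + 1)]
    ring

lemma integral_fract_mul_logWeight (m : ℕ) :
    ∫ x in Set.Ioi (1 : ℝ), Int.fract x * logWeight m x =
      1 - ∑ k ∈ Finset.range (m + 1), stieltjes k / (k.factorial : ℝ) := by
  have h := tendsto_nhds_unique (tendsto_sum_stieltjesSeq m)
    (tendsto_finsetSum _ fun j _ => (tendsto_stieltjesSeq j).div_const _)
  linarith

theorem statement9 (m : ℕ) :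
    (1 / (Nat.factorial m : ℝ)) *
        (∫ x in Set.Ioi (1 : ℝ), Int.fract x * Real.log x ^ m / x ^ 2) =
      1 - ∑ k ∈ Finset.range (m + 1), stieltjes k / (Nat.factorial k : ℝ) ∧
    ellGen 0 m = -((1 / (Nat.factorial m : ℝ)) *
        ∫ x in Set.Ioi (1 : ℝ), Int.fract x * Real.log x ^ m / x ^ 2) := by
  have key : (1 / (Nat.factorial m : ℝ)) *
        (∫ x in Set.Ioi (1 : ℝ), Int.fract x * Real.log x ^ m / x ^ 2) =
      1 - ∑ k ∈ Finset.range (m + 1), stieltjes k / (Nat.factorial k : ℝ) := by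
    rw [← integral_fract_mul_logWeight, ← integral_const_mul]
    congr 1
    funext x
    simp only [logWeight]
    ring
  refine ⟨key, ?_⟩
  rw [key]
  simp [ellGen]
  ring
end

section
/- For every nonnegative integer m and every complex number s with Re s > 1/2 and s ≠ 1, one has ∑_{k=0}^{m} ((-s)^k / k!) · ζ^{(k)}(s) − (s/(s−1))^{m+1} = −(s^{m+1}/m!) ∫_{1}^{∞} {x} (log x)^m / x^{s+1} dx, where ζ^{(k)} denotes the k-th derivative of the Riemann zeta function. -/
open Filter Finset MeasureTheory

/-- The function `{t} (log t)ᵐ` on `(1, ∞)`, extended by zero. -/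
noncomputable def fractLogPow (m : ℕ) (t : ℝ) : ℂ :=
  (Set.Ioi (1 : ℝ)).indicator (fun t ↦ ((Int.fract t : ℝ) : ℂ) * ((Real.log t : ℝ) : ℂ) ^ m) t

/-- The integral `∫₁^∞ {x} (log x)ᵐ x^(-s-1) dx`, as a Mellin transform. -/
noncomputable def fractLogIntegral (m : ℕ) (s : ℂ) : ℂ := mellin (fractLogPow m) (-s)

lemma fractLogPow_succ (m : ℕ) :
    fractLogPow (m + 1) = fun t : ℝ ↦ Real.log t • fractLogPow m t := by
  funext t
  by_cases ht : t ∈ Set.Ioi (1 : ℝ)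
  · simp only [fractLogPow, Set.indicator_of_mem ht, Complex.real_smul]
    ring
  · simp [fractLogPow, Set.indicator_of_notMem ht]

lemma norm_fractLogPow_zero_le (t : ℝ) : ‖fractLogPow 0 t‖ ≤ 1 := by
  refine (norm_indicator_le_norm_self _ _).trans ?_
  simpa [abs_of_nonneg (Int.fract_nonneg t)] using (Int.fract_lt_one t).le

lemma locallyIntegrableOn_fractLogPow (m : ℕ) :
    LocallyIntegrableOn (fractLogPow m) (Set.Ioi 0) := by
  induction m with
  | zero =>
    have hmeas : Measurable (fractLogPow 0) := by
      refine Measurable.indicator ?_ measurableSet_Ioi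
      fun_prop
    refine LocallyIntegrable.locallyIntegrableOn ?_ _
    exact (locallyIntegrable_const (1 : ℝ)).mono hmeas.aestronglyMeasurable
      (Eventually.of_forall fun t ↦ by simpa using norm_fractLogPow_zero_le t)
  | succ m ih =>
    rw [fractLogPow_succ]
    exact ih.continuousOn_smul isOpen_Ioi.isLocallyClosed
      (Real.continuousOn_log.mono fun t ht ↦ (ne_of_gt ht : t ≠ 0))

lemma fractLogPow_isBigO_atTop (m : ℕ) {b : ℝ} (hb : b < 0) :
    fractLogPow m =O[atTop] fun t : ℝ ↦ t ^ (-b) := by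
  induction m generalizing b with
  | zero =>
    refine Asymptotics.IsBigO.of_bound 1 ?_
    filter_upwards [eventually_ge_atTop 1] with t ht
    have h : 1 ≤ t ^ (-b) := Real.one_le_rpow ht (by linarith)
    rw [one_mul, Real.norm_of_nonneg (by linarith)]
    exact (norm_fractLogPow_zero_le t).trans h
  | succ m ih =>
    rw [fractLogPow_succ]
    exact isBigO_rpow_top_log_smul (a := b / 2) (by linarith) (ih (by linarith))

lemma fractLogPow_isBigO_zero (m : ℕ) (b : ℝ) :
    fractLogPow m =O[nhdsWithin 0 (Set.Ioi 0)] fun t : ℝ ↦ t ^ (-b) := by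
  refine Asymptotics.IsBigO.of_bound 1 ?_
  filter_upwards [mem_nhdsWithin_of_mem_nhds (Iio_mem_nhds (zero_lt_one' ℝ)),
    self_mem_nhdsWithin] with t ht ht0
  have : t ∉ Set.Ioi (1 : ℝ) := lt_asymm (a := t) ht
  simp [fractLogPow, Set.indicator_of_notMem this]

lemma hasDerivAt_fractLogIntegral (m : ℕ) {s : ℂ} (hs : 0 < s.re) :
    HasDerivAt (fractLogIntegral m) (-fractLogIntegral (m + 1) s) s := by
  have h := (mellin_hasDerivAt_of_isBigO_rpow (a := -s.re / 2) (b := -s.re - 1) (s := -s)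
    (locallyIntegrableOn_fractLogPow m)
    (fractLogPow_isBigO_atTop m (by linarith)) (by rw [Complex.neg_re]; linarith)
    (fractLogPow_isBigO_zero m _) (by rw [Complex.neg_re]; linarith)).2
  rw [← fractLogPow_succ] at h
  exact (h.comp s (hasDerivAt_neg s)).congr_deriv (by simp [fractLogIntegral])

lemma fractLogIntegral_eq (m : ℕ) (s : ℂ) :
    fractLogIntegral m s = ∫ x in Set.Ioi (1 : ℝ),
      ((Int.fract x : ℝ) : ℂ) * ((Real.log x : ℝ) : ℂ) ^ m / (x : ℂ) ^ (s + 1) := by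
  have h : (fun t : ℝ ↦ (t : ℂ) ^ (-s - 1) • fractLogPow m t) =
      (Set.Ioi (1 : ℝ)).indicator fun x : ℝ ↦
        ((Int.fract x : ℝ) : ℂ) * ((Real.log x : ℝ) : ℂ) ^ m / (x : ℂ) ^ (s + 1) := by
    funext t
    by_cases ht : t ∈ Set.Ioi (1 : ℝ)
    · simp only [fractLogPow, Set.indicator_of_mem ht, smul_eq_mul]
      rw [show -s - 1 = -(s + 1) by ring, Complex.cpow_neg, div_eq_mul_inv, mul_comm]
    · simp [fractLogPow, Set.indicator_of_notMem ht]
  rw [fractLogIntegral, mellin, h, setIntegral_indicator measurableSet_Ioi,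
    Set.inter_eq_right.mpr (Set.Ioi_subset_Ioi zero_le_one)]

lemma integrableOn_fract_div_cpow {s : ℂ} (hs : 0 < s.re) :
    IntegrableOn (fun x : ℝ ↦ ((Int.fract x : ℝ) : ℂ) * (x : ℂ) ^ (-(s + 1))) (Set.Ioi 1) := by
  have h : IntegrableOn (fun x : ℝ ↦ (x : ℂ) ^ (-(s + 1))) (Set.Ioi 1) :=
    integrableOn_Ioi_cpow_of_lt (by simp; linarith) one_pos
  refine h.bdd_mul (c := 1) (by fun_prop) (Eventually.of_forall fun x ↦ ?_)
  simpa [abs_of_nonneg (Int.fract_nonneg x)] using (Int.fract_lt_one x).le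

lemma riemannZeta_eq_of_one_lt_re {s : ℂ} (hs : 1 < s.re) :
    riemannZeta s = s / (s - 1) - s * fractLogIntegral 0 s := by
  have hs1 : s - 1 ≠ 0 := sub_ne_zero.mpr fun h ↦ by simp [h] at hs
  have hL : LSeries 1 s = s * ∫ t in Set.Ioi (1 : ℝ),
      (∑ k ∈ Finset.Icc 1 ⌊t⌋₊, (1 : ℕ → ℂ) k) * (t : ℂ) ^ (-(s + 1)) := by
    refine LSeries_eq_mul_integral' 1 zero_le_one hs ?_
    refine Asymptotics.IsBigO.of_bound 1 (Eventually.of_forall fun n ↦ ?_)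
    simp
  have hint : ∫ t in Set.Ioi (1 : ℝ),
      (∑ k ∈ Finset.Icc 1 ⌊t⌋₊, (1 : ℕ → ℂ) k) * (t : ℂ) ^ (-(s + 1)) =
      (∫ t in Set.Ioi (1 : ℝ), (t : ℂ) ^ (-s)) - fractLogIntegral 0 s := by
    rw [fractLogIntegral_eq]
    simp only [pow_zero, mul_one, div_eq_mul_inv, ← Complex.cpow_neg]
    rw [← integral_sub (integrableOn_Ioi_cpow_of_lt (by simpa using hs) one_pos)
      (integrableOn_fract_div_cpow (by linarith))]
    refine setIntegral_congr_fun measurableSet_Ioi fun t (ht : 1 < t) ↦ ?_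
    have ht0 : (t : ℂ) ≠ 0 := Complex.ofReal_ne_zero.mpr (by linarith)
    have hfl : ((⌊t⌋₊ : ℕ) : ℂ) = (t : ℂ) - ((Int.fract t : ℝ) : ℂ) := by
      rw [← Complex.ofReal_natCast, ← Complex.ofReal_sub, natCast_floor_eq_intCast_floor
        (by linarith), Int.self_sub_fract]
    have hpow : (t : ℂ) ^ (-s) = t * (t : ℂ) ^ (-(s + 1)) := by
      rw [show -s = 1 + -(s + 1) by ring, Complex.cpow_add _ _ ht0, Complex.cpow_one]
    simp [hfl, hpow, sub_mul]
  rw [← LSeries_one_eq_riemannZeta hs, hL, hint,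
    integral_Ioi_cpow_of_lt (by simpa using hs) one_pos]
  have : -s + 1 ≠ 0 := fun h ↦ hs1 (by linear_combination -h)
  rw [Complex.ofReal_one, Complex.one_cpow]
  field_simp
  ring

lemma riemannZeta_eq_sub_fractLogIntegral {s : ℂ} (hs : 0 < s.re) (hs1 : s ≠ 1) :
    riemannZeta s = s / (s - 1) - s * fractLogIntegral 0 s := by
  have hopen : IsOpen {z : ℂ | 0 < z.re} := isOpen_lt continuous_const Complex.continuous_re
  have hf : AnalyticOnNhd ℂ riemannZeta₁ {z | 0 < z.re} :=
    differentiable_riemannZeta₁.differentiableOn.analyticOnNhd hopen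
  have hg : AnalyticOnNhd ℂ (fun z ↦ z - (z - 1) * (z * fractLogIntegral 0 z)) {z | 0 < z.re} := by
    refine DifferentiableOn.analyticOnNhd (fun z hz ↦ ?_) hopen
    have := (hasDerivAt_fractLogIntegral 0 hz).differentiableAt
    exact DifferentiableAt.differentiableWithinAt (by fun_prop)
  have heq := hf.eqOn_of_preconnected_of_eventuallyEq hg
    (convex_halfSpace_re_gt 0).isPreconnected (z₀ := 2) (by simp) (by
      filter_upwards [(isOpen_lt continuous_const Complex.continuous_re).mem_nhds
        (show (1 : ℝ) < (2 : ℂ).re by norm_num)] with z (hz : 1 < z.re)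
      have hz1 : z ≠ 1 := fun h ↦ by simp [h] at hz
      have hz1' := sub_ne_zero.mpr hz1
      have h1 := riemannZeta_eq_inv_sub_mul hz1
      rw [riemannZeta_eq_of_one_lt_re hz] at h1
      field_simp at h1
      linear_combination -h1)
  have hs1' := sub_ne_zero.mpr hs1
  rw [riemannZeta_eq_inv_sub_mul hs1, heq hs]
  field_simp

lemma hasDerivAt_iteratedDeriv_riemannZeta (k : ℕ) {s : ℂ} (hs : s ≠ 1) :
    HasDerivAt (iteratedDeriv k riemannZeta) (iteratedDeriv (k + 1) riemannZeta s) s := by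
  rw [iteratedDeriv_succ]
  refine DifferentiableAt.hasDerivAt ?_
  rw [iteratedDeriv_eq_iterate]
  exact (analyticOn_riemannZeta.iterated_deriv k s hs).differentiableAt

/-- The derivative of the Taylor-type sum telescopes. -/
lemma hasDerivAt_sum_iteratedDeriv {f : ℂ → ℂ} {s : ℂ} (m : ℕ)
    (hf : ∀ k, HasDerivAt (iteratedDeriv k f) (iteratedDeriv (k + 1) f s) s) :
    HasDerivAt (fun z ↦ ∑ k ∈ Finset.range (m + 1),
        ((-z) ^ k / (Nat.factorial k : ℂ)) * iteratedDeriv k f z)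
      (((-s) ^ m / (Nat.factorial m : ℂ)) * iteratedDeriv (m + 1) f s) s := by
  induction m with
  | zero => simpa using hf 0
  | succ m ih =>
    simp_rw [Finset.sum_range_succ _ (m + 1)]
    have h := ih.add ((((hasDerivAt_neg s).pow (m + 1)).div_const
      (Nat.factorial (m + 1) : ℂ)).mul (hf (m + 1)))
    refine h.congr_deriv ?_
    have h1 : (Nat.factorial m : ℂ) ≠ 0 := Nat.cast_ne_zero.mpr m.factorial_ne_zero
    have h2 : (m : ℂ) + 1 ≠ 0 := Nat.cast_add_one_ne_zero m
    simp only [Nat.factorial_succ, Nat.cast_mul, Nat.cast_add, Nat.cast_one,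
      Nat.add_sub_cancel, Pi.pow_apply]
    field_simp
    ring

lemma sum_iteratedDeriv_riemannZeta_eq (m : ℕ) {s : ℂ} (hs : 0 < s.re) (hs1 : s ≠ 1) :
    ∑ k ∈ Finset.range (m + 1),
        ((-s) ^ k / (Nat.factorial k : ℂ)) * iteratedDeriv k riemannZeta s =
      (s / (s - 1)) ^ (m + 1) - s ^ (m + 1) / (Nat.factorial m : ℂ) * fractLogIntegral m s := by
  induction m generalizing s with
  | zero => simpa using riemannZeta_eq_sub_fractLogIntegral hs hs1
  | succ m ih =>
    have hs1' := sub_ne_zero.mpr hs1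
    have h1 : (Nat.factorial m : ℂ) ≠ 0 := Nat.cast_ne_zero.mpr m.factorial_ne_zero
    have h2 : (m : ℂ) + 1 ≠ 0 := Nat.cast_add_one_ne_zero m
    have hL := hasDerivAt_sum_iteratedDeriv m
      fun k ↦ hasDerivAt_iteratedDeriv_riemannZeta k hs1
    have hR := (((hasDerivAt_id s).div ((hasDerivAt_id s).sub_const 1) hs1').pow (m + 1)).sub
      ((((hasDerivAt_id s).pow (m + 1)).div_const (Nat.factorial m : ℂ)).mul
        (hasDerivAt_fractLogIntegral m hs))
    have heq := hL.unique (hR.congr_of_eventuallyEq (by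
      filter_upwards [(isOpen_lt continuous_const Complex.continuous_re).mem_nhds hs,
        isOpen_ne.mem_nhds hs1] with z hz hz1
      exact ih hz hz1))
    rw [Finset.sum_range_succ, ih hs hs1, pow_succ (-s) m, Nat.factorial_succ]
    simp only [Nat.cast_mul, Nat.cast_add, Nat.cast_one, Nat.add_sub_cancel, Pi.pow_apply,
      Pi.div_apply, id] at heq ⊢
    have hstep : (-s) ^ m * -s / (((m : ℂ) + 1) * (Nat.factorial m : ℂ)) *
        iteratedDeriv (m + 1) riemannZeta s = -s / ((m : ℂ) + 1) *
        ((-s) ^ m / (Nat.factorial m : ℂ) * iteratedDeriv (m + 1) riemannZeta s) := by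
      field_simp
    rw [hstep, heq]
    simp only [div_pow]
    field_simp
    ring

theorem statement10 (m : ℕ) (s : ℂ) (hs : 1 / 2 < s.re) (hs1 : s ≠ 1) :
    (∑ k ∈ Finset.range (m + 1),
        ((-s) ^ k / (Nat.factorial k : ℂ)) * iteratedDeriv k riemannZeta s) -
      (s / (s - 1)) ^ (m + 1) =
    -(s ^ (m + 1) / (Nat.factorial m : ℂ)) *
      ∫ x in Set.Ioi (1 : ℝ),
        ((Int.fract x : ℝ) : ℂ) * ((Real.log x : ℝ) : ℂ) ^ m / (x : ℂ) ^ (s + 1) := by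
  rw [sum_iteratedDeriv_riemannZeta_eq m (by linarith) hs1, fractLogIntegral_eq]
  ring
end

section
/- For every nonnegative integer m, lim_{s→1} ( ∑_{k=0}^{m} ((-s)^k / k!) · ζ^{(k)}(s) − (s/(s−1))^{m+1} ) = −1 + ∑_{k=0}^{m} γ_k / k!, where ζ^{(k)} denotes the k-th derivative of the Riemann zeta function and the limit is taken over s ∈ ℂ \ {1}. -/
open Filter Finset MeasureTheory

/-- The entire function `z ↦ (exp (L z) - 1) / z`, with value `L` at `z = 0`. -/
noncomputable def expSlope (L z : ℂ) : ℂ := dslope (fun w => Complex.exp (L * w)) 0 z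

lemma expSlope_zero_right (L : ℂ) : expSlope L 0 = L := by
  have h : HasDerivAt (fun w : ℂ => Complex.exp (L * w)) L 0 := by
    simpa using ((hasDerivAt_id (0 : ℂ)).const_mul L).cexp
  rw [expSlope, dslope_same, h.deriv]

lemma expSlope_of_ne (L : ℂ) {z : ℂ} (hz : z ≠ 0) :
    expSlope L z = (Complex.exp (L * z) - 1) / z := by
  rw [expSlope, dslope_of_ne _ hz, slope_def_field]
  simp

lemma expSlope_zero_left (z : ℂ) : expSlope 0 z = 0 := by
  rcases eq_or_ne z 0 with rfl | hz
  · exact expSlope_zero_right 0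
  · simp [expSlope_of_ne _ hz]

lemma differentiable_expSlope (L : ℂ) : Differentiable ℂ (expSlope L) := by
  rw [← differentiableOn_univ]
  exact (Complex.differentiableOn_dslope univ_mem).2 (by fun_prop)

lemma hasDerivAt_expSlope_left (L z : ℂ) :
    HasDerivAt (fun L => expSlope L z) (Complex.exp (L * z)) L := by
  rcases eq_or_ne z 0 with rfl | hz
  · simp only [expSlope_zero_right, mul_zero, Complex.exp_zero]
    exact hasDerivAt_id L
  · simp only [expSlope_of_ne _ hz]
    simpa [hz] using ((((hasDerivAt_id L).mul_const z).cexp.sub_const 1).div_const z)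

lemma iteratedDeriv_expSlope_zero (L : ℂ) (n : ℕ) :
    iteratedDeriv n (expSlope L) 0 = L ^ (n + 1) / (n + 1) := by
  have hcd : ContDiff ℂ ⊤ (expSlope L) := (differentiable_expSlope L).contDiff
  have hfun : (fun z => Complex.exp (L * z)) = fun z => 1 + z * expSlope L z := by
    funext z
    rcases eq_or_ne z 0 with rfl | hz
    · simp
    · rw [expSlope_of_ne _ hz]; field_simp; ring
  have hstep : ∀ n : ℕ, ∀ z : ℂ, iteratedDeriv (n + 1) (fun z => z * expSlope L z) z =
      z * iteratedDeriv (n + 1) (expSlope L) z + (n + 1) * iteratedDeriv n (expSlope L) z := by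
    have hd : ∀ k : ℕ, ∀ z : ℂ,
        HasDerivAt (iteratedDeriv k (expSlope L)) (iteratedDeriv (k + 1) (expSlope L) z) z := by
      intro k z
      rw [iteratedDeriv_succ]
      exact (hcd.differentiable_iteratedDeriv k
        (by exact_mod_cast WithTop.coe_lt_top _) z).hasDerivAt
    intro n
    induction n with
    | zero =>
      intro z
      have := (hasDerivAt_id z).mul (hd 0 z)
      simp only [iteratedDeriv_zero] at this
      rw [iteratedDeriv_succ, iteratedDeriv_zero]
      refine (this.deriv.trans ?_)
      simp; ring
    | succ n ih =>
      intro z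
      rw [iteratedDeriv_succ, funext ih]
      have := ((hasDerivAt_id z).mul (hd (n + 1) z)).add ((hd n z).const_mul ((n : ℂ) + 1))
      refine (this.deriv.trans ?_)
      simp; ring
  have h := congrFun (iteratedDeriv_cexp_const_mul (n + 1) L) 0
  rw [hfun, iteratedDeriv_const_add n.succ_pos 1, hstep n 0] at h
  have hn : (n : ℂ) + 1 ≠ 0 := Nat.cast_add_one_ne_zero n
  simp only [zero_mul, zero_add, mul_zero, Complex.exp_zero, mul_one] at h
  rw [eq_div_iff hn, mul_comm, h]

/-- In the variable `z = 1 - s`, the difference between `(k + 1) ^ (-s)` and the integral of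
`x ^ (-s)` over `[k, k + 1]` (for `k = 0`, the function `1`). -/
noncomputable def zetaTerm (k : ℕ) (z : ℂ) : ℂ :=
  Complex.exp (Real.log (k + 1) * (z - 1)) -
    (expSlope (Real.log (k + 1)) z - expSlope (Real.log k) z)

lemma differentiable_zetaTerm (k : ℕ) : Differentiable ℂ (zetaTerm k) := by
  have := differentiable_expSlope (Real.log (k + 1))
  have := differentiable_expSlope (Real.log k)
  unfold zetaTerm
  fun_prop

lemma sum_zetaTerm (N : ℕ) (z : ℂ) :
    ∑ k ∈ range N, zetaTerm k z =
      ∑ k ∈ range N, Complex.exp (Real.log (k + 1) * (z - 1)) - expSlope (Real.log N) z := by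
  simp only [zetaTerm, sum_sub_distrib]
  congr 1
  have := sum_range_sub (fun k : ℕ => expSlope (Real.log k) z) N
  simp only [Nat.cast_add, Nat.cast_one, Nat.cast_zero, Real.log_zero, Complex.ofReal_zero,
    expSlope_zero_left, sub_zero] at this
  rw [← this, sum_sub_distrib]

lemma hasDerivAt_exp_log_mul {x : ℝ} (hx : 0 < x) (w : ℂ) :
    HasDerivAt (fun x : ℝ => Complex.exp (Real.log x * w))
      (w * Complex.exp (Real.log x * (w - 1))) x := by
  convert (((Real.hasDerivAt_log hx.ne').ofReal_comp).mul_const w).cexp using 1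
  have : Complex.exp (Real.log x) = x := by rw [← Complex.ofReal_exp, Real.exp_log hx]
  rw [mul_sub, mul_one, Complex.exp_sub, this, Complex.ofReal_inv]
  field_simp

lemma hasDerivAt_expSlope_log {x : ℝ} (hx : 0 < x) (z : ℂ) :
    HasDerivAt (fun x : ℝ => expSlope (Real.log x) z)
      (Complex.exp (Real.log x * (z - 1))) x := by
  have h := (hasDerivAt_expSlope_left (Real.log x) z).comp x
    ((Real.hasDerivAt_log hx.ne').ofReal_comp)
  refine h.congr_deriv ?_
  have : Complex.exp (Real.log x) = x := by rw [← Complex.ofReal_exp, Real.exp_log hx]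
  rw [mul_sub, mul_one, Complex.exp_sub, this, Complex.ofReal_inv, div_eq_mul_inv]

lemma norm_exp_log_mul {x : ℝ} (hx : 0 < x) (w : ℂ) :
    ‖Complex.exp (Real.log x * w)‖ = x ^ w.re := by
  rw [Complex.norm_exp, Real.rpow_def_of_pos hx]
  simp

lemma norm_zetaTerm_le {k : ℕ} (hk : 1 ≤ k) {z : ℂ} (hz : z ∈ Metric.ball (0 : ℂ) (1 / 2)) :
    ‖zetaTerm k z‖ ≤ 3 / 2 * (k : ℝ) ^ (-(3 / 2) : ℝ) := by
  have hk1 : (1 : ℝ) ≤ k := by exact_mod_cast hk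
  have hz' : ‖z‖ < 1 / 2 := by simpa using hz
  have hre : z.re < 1 / 2 := (Complex.re_le_norm z).trans_lt hz'
  have hnz : ‖z - 1‖ ≤ 3 / 2 := by
    have := norm_sub_le z 1
    rw [norm_one] at this
    linarith
  set C : ℝ := 3 / 2 * (k : ℝ) ^ (-(3 / 2) : ℝ) with hC
  have hC0 : 0 ≤ C := by positivity
  have hpos : ∀ x ∈ Set.Icc (k : ℝ) (k + 1), 0 < x := fun x hx => by linarith [hx.1]
  have hexp : ∀ x ∈ Set.Icc (k : ℝ) (k + 1),
      ‖Complex.exp (Real.log (k + 1 : ℝ) * (z - 1)) - Complex.exp (Real.log x * (z - 1))‖ ≤ C := by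
    intro x hx
    have h := (convex_Icc (k : ℝ) (k + 1)).norm_image_sub_le_of_norm_hasDerivWithin_le (C := C)
      (fun y hy => (hasDerivAt_exp_log_mul (hpos y hy) (z - 1)).hasDerivWithinAt) (fun y hy => by
        rw [norm_mul, norm_exp_log_mul (hpos y hy), hC]
        have hexponent : (z - 1 - 1).re ≤ -(3 / 2) := by
          rw [Complex.sub_re, Complex.sub_re, Complex.one_re]; linarith
        refine mul_le_mul hnz ?_ (Real.rpow_nonneg (hpos y hy).le _) (by norm_num)
        refine (Real.rpow_le_rpow_of_exponent_le (hk1.trans hy.1) hexponent).trans ?_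
        exact Real.rpow_le_rpow_of_nonpos (by linarith) hy.1 (by norm_num)) hx
      (Set.right_mem_Icc.2 (by linarith))
    refine h.trans (mul_le_of_le_one_right hC0 ?_)
    rw [Real.norm_of_nonneg (by linarith [hx.2])]
    linarith [hx.1]
  have h := (convex_Icc (k : ℝ) (k + 1)).norm_image_sub_le_of_norm_hasDerivWithin_le (C := C)
    (f := fun x : ℝ => (x : ℂ) * Complex.exp (Real.log (k + 1 : ℝ) * (z - 1)) -
      expSlope (Real.log x) z)
    (fun x hx => (((hasDerivAt_id x).ofReal_comp.mul_const _).sub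
      (hasDerivAt_expSlope_log (hpos x hx) z)).hasDerivWithinAt)
    (fun x hx => by simpa using hexp x hx)
    (Set.left_mem_Icc.2 (by linarith)) (Set.right_mem_Icc.2 (by linarith))
  have hone : ‖((k : ℝ) + 1) - k‖ = 1 := by simp
  rw [hone, mul_one] at h
  refine (congrArg norm ?_).trans_le h
  simp only [zetaTerm]
  push_cast
  ring

lemma tendstoUniformlyOn_sum_zetaTerm :
    TendstoUniformlyOn (fun N z => ∑ k ∈ range N, zetaTerm k z) (fun z => ∑' k, zetaTerm k z)
      atTop (Metric.ball (0 : ℂ) (1 / 2)) := by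
  refine tendstoUniformlyOn_tsum_nat_eventually
    ((Real.summable_nat_rpow.2 (by norm_num : (-(3 / 2) : ℝ) < -1)).mul_left (3 / 2)) ?_
  filter_upwards [eventually_ge_atTop 1] with k hk z hz using norm_zetaTerm_le hk hz

lemma tendsto_sum_zetaTerm_of_re_neg {z : ℂ} (hz : z.re < 0) :
    Tendsto (fun N => ∑ k ∈ range N, zetaTerm k z) atTop (nhds (riemannZeta₀ (1 - z))) := by
  have hz0 : z ≠ 0 := by rintro rfl; simp at hz
  have hre : 1 < (1 - z).re := by
    rw [Complex.sub_re, Complex.one_re]; linarith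
  have hsum : Summable fun k : ℕ => 1 / ((k : ℂ) + 1) ^ (1 - z) := by
    simpa using (summable_nat_add_iff 1).2 (Complex.summable_one_div_nat_cpow.2 hre)
  have h1 := hsum.hasSum.tendsto_sum_nat
  rw [← zeta_eq_tsum_one_div_nat_add_one_cpow hre] at h1
  have hexp : Tendsto (fun N : ℕ => Complex.exp (Real.log N * z)) atTop (nhds 0) := by
    rw [tendsto_zero_iff_norm_tendsto_zero]
    have := (tendsto_rpow_neg_atTop (y := -z.re) (by linarith)).comp
      (tendsto_natCast_atTop_atTop (R := ℝ))
    refine this.congr' ?_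
    filter_upwards [eventually_ge_atTop 1] with N hN
    rw [norm_exp_log_mul (by exact_mod_cast hN)]
    simp
  have h2 := h1.sub ((hexp.sub_const 1).div_const z)
  have h0 : riemannZeta₀ (1 - z) = riemannZeta (1 - z) - (0 - 1) / z := by
    have hne : 1 - z ≠ 1 := by simpa using hz0
    rw [riemannZeta_eq_inv_sub_add hne]
    have : (1 - z - 1) = -z := by ring
    rw [this, inv_neg]
    ring
  rw [h0]
  refine h2.congr fun N => ?_
  rw [sum_zetaTerm, expSlope_of_ne _ hz0]
  congr 1
  refine sum_congr rfl fun k _ => ?_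
  have hk : (k : ℂ) + 1 ≠ 0 := Nat.cast_add_one_ne_zero k
  rw [one_div, ← Complex.cpow_neg, Complex.cpow_def_of_ne_zero hk, neg_sub]
  congr 2
  rw [Complex.ofReal_log (by positivity)]
  push_cast
  rfl

lemma tsum_zetaTerm_eq {z : ℂ} (hz : z ∈ Metric.ball (0 : ℂ) (1 / 2)) :
    ∑' k, zetaTerm k z = riemannZeta₀ (1 - z) := by
  have hd : DifferentiableOn ℂ (fun z => ∑' k, zetaTerm k z) (Metric.ball (0 : ℂ) (1 / 2)) :=
    tendstoUniformlyOn_sum_zetaTerm.tendstoLocallyUniformlyOn.differentiableOn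
      (Eventually.of_forall fun N => by
        have := differentiable_zetaTerm
        fun_prop) Metric.isOpen_ball
  have hg : DifferentiableOn ℂ (fun z => riemannZeta₀ (1 - z)) (Metric.ball (0 : ℂ) (1 / 2)) := by
    fun_prop
  have hmem : (-(1 / 4) : ℂ) ∈ Metric.ball (0 : ℂ) (1 / 2) := by
    simp; norm_num
  refine (hd.analyticOnNhd Metric.isOpen_ball).eqOn_of_preconnected_of_eventuallyEq
    (hg.analyticOnNhd Metric.isOpen_ball) (convex_ball _ _).isPreconnected hmem ?_ hz
  have hneg : ∀ᶠ w : ℂ in nhds (-(1 / 4)), w.re < 0 :=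
    (isOpen_lt Complex.continuous_re continuous_const).mem_nhds (by simp)
  filter_upwards [hneg, Metric.isOpen_ball.mem_nhds hmem] with w hw hwb
  exact tendsto_nhds_unique (tendstoUniformlyOn_sum_zetaTerm.tendsto_at hwb)
    (tendsto_sum_zetaTerm_of_re_neg hw)

lemma TendstoLocallyUniformlyOn.iteratedDeriv {ι : Type*} {φ : Filter ι} {U : Set ℂ}
    {F : ι → ℂ → ℂ} {f : ℂ → ℂ} (hf : TendstoLocallyUniformlyOn F f φ U)
    (hF : ∀ᶠ i in φ, DifferentiableOn ℂ (F i) U) (hU : IsOpen U) (n : ℕ) :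
    TendstoLocallyUniformlyOn (fun i => iteratedDeriv n (F i)) (iteratedDeriv n f) φ U := by
  suffices h : TendstoLocallyUniformlyOn (fun i => _root_.iteratedDeriv n (F i))
      (_root_.iteratedDeriv n f) φ U ∧
      ∀ᶠ i in φ, DifferentiableOn ℂ (_root_.iteratedDeriv n (F i)) U from h.1
  induction n with
  | zero => simpa using ⟨hf, hF⟩
  | succ n ih =>
    simp only [iteratedDeriv_succ]
    exact ⟨ih.1.deriv ih.2 hU, ih.2.mono fun i hi => hi.deriv hU⟩

lemma iteratedDeriv_sum_zetaTerm_zero (n N : ℕ) :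
    iteratedDeriv n (fun z => ∑ k ∈ range N, zetaTerm k z) 0 =
      (((∑ k ∈ range N, Real.log ((k : ℝ) + 1) ^ n / ((k : ℝ) + 1)) -
        Real.log (N : ℝ) ^ (n + 1) / ((n : ℝ) + 1) : ℝ) : ℂ) := by
  simp only [sum_zetaTerm]
  have hE : ∀ k : ℕ, ContDiff ℂ n fun z => Complex.exp (Real.log (k + 1) * (z - 1)) := by
    intro k; fun_prop
  rw [iteratedDeriv_fun_sub (ContDiff.sum fun k _ => hE k).contDiffAt
    (differentiable_expSlope _).contDiff.contDiffAt, iteratedDeriv_expSlope_zero,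
    iteratedDeriv_fun_sum fun k _ => (hE k).contDiffAt]
  push_cast
  congr 1
  refine sum_congr rfl fun k _ => ?_
  have hk : Complex.exp (Real.log ((k : ℝ) + 1)) = k + 1 := by
    rw [← Complex.ofReal_exp, Real.exp_log (by positivity)]
    push_cast; rfl
  have hfun : (fun z => Complex.exp (Real.log ((k : ℝ) + 1) * (z - 1))) =
      fun z => ((k : ℂ) + 1)⁻¹ * Complex.exp (Real.log ((k : ℝ) + 1) * z) := by
    funext z
    rw [mul_sub, mul_one, Complex.exp_sub, hk]
    field_simp
  rw [hfun, iteratedDeriv_const_mul_field, iteratedDeriv_cexp_const_mul]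
  simp
  ring

/-- The Laurent coefficients of `ζ` at `1` are given by the Stieltjes constants. -/
theorem iteratedDeriv_riemannZeta₀_one (n : ℕ) :
    (-1) ^ n * iteratedDeriv n riemannZeta₀ 1 = stieltjes n := by
  have h0 : (0 : ℂ) ∈ Metric.ball (0 : ℂ) (1 / 2) := by simp
  have hlim := (tendstoUniformlyOn_sum_zetaTerm.tendstoLocallyUniformlyOn.iteratedDeriv
    (Eventually.of_forall fun N => by
      have := differentiable_zetaTerm
      fun_prop) Metric.isOpen_ball n).tendsto_at h0
  have heq : iteratedDeriv n (fun z => ∑' k, zetaTerm k z) 0 =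
      (-1) ^ n * iteratedDeriv n riemannZeta₀ 1 := by
    have hEq : Set.EqOn (fun z => ∑' k, zetaTerm k z) (fun z => riemannZeta₀ (1 - z))
      (Metric.ball (0 : ℂ) (1 / 2)) := fun z hz => tsum_zetaTerm_eq hz
    rw [hEq.iteratedDeriv_of_isOpen Metric.isOpen_ball n h0, iteratedDeriv_comp_const_sub]
    simp
  simp only [heq, iteratedDeriv_sum_zetaTerm_zero] at hlim
  have hre := (Complex.continuous_re.tendsto _).comp hlim
  have him := (Complex.continuous_im.tendsto _).comp hlim
  simp only [Function.comp_def, Complex.ofReal_re, Complex.ofReal_im] at hre him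
  have him0 := tendsto_nhds_unique him tendsto_const_nhds
  rw [stieltjes, hre.limUnder_eq]
  exact Complex.ext (by simp) (by simpa using him0)

lemma iteratedDeriv_riemannZeta_eq (k : ℕ) {s : ℂ} (hs : s ≠ 1) :
    iteratedDeriv k riemannZeta s =
      (-1) ^ k * k.factorial / (s - 1) ^ (k + 1) + iteratedDeriv k riemannZeta₀ s := by
  have hs1 : s - 1 ≠ 0 := sub_ne_zero.2 hs
  have hEq : Set.EqOn riemannZeta (fun s => (s - 1)⁻¹ + riemannZeta₀ s) {1}ᶜ :=
    fun s hs => riemannZeta_eq_inv_sub_add hs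
  rw [hEq.iteratedDeriv_of_isOpen isOpen_compl_singleton k hs, iteratedDeriv_fun_add
    (by fun_prop (disch := assumption)) differentiable_riemannZeta₀.contDiff.contDiffAt]
  congr 1
  have h := congrFun (iteratedDeriv_comp_sub_const k (fun s : ℂ => s⁻¹) 1) s
  rw [h, iteratedDeriv_eq_iterate, iter_deriv_inv]
  have he : (-1 - k : ℤ) = -((k + 1 : ℕ) : ℤ) := by push_cast; ring
  rw [he, zpow_neg, zpow_natCast, div_eq_mul_inv]

lemma sum_pow_div_sub_one_pow (m : ℕ) {s : ℂ} (hs : s ≠ 1) :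
    ∑ k ∈ range m, s ^ k / (s - 1) ^ (k + 1) = (s / (s - 1)) ^ m - 1 := by
  have hs1 : s - 1 ≠ 0 := sub_ne_zero.2 hs
  induction m with
  | zero => simp
  | succ m ih =>
    rw [sum_range_succ, ih, div_pow, div_pow]
    field_simp
    ring

theorem statement11 (m : ℕ) :
    Tendsto (fun s : ℂ =>
        (∑ k ∈ Finset.range (m + 1),
          ((-s) ^ k / (Nat.factorial k : ℂ)) * iteratedDeriv k riemannZeta s) -
          (s / (s - 1)) ^ (m + 1))
      (nhdsWithin 1 {(1 : ℂ)}ᶜ)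
      (nhds (((-1 + ∑ k ∈ Finset.range (m + 1), stieltjes k / (Nat.factorial k : ℝ) : ℝ) : ℂ))) := by
  have hcont : Continuous fun s : ℂ => -1 + ∑ k ∈ range (m + 1),
      ((-s) ^ k / (Nat.factorial k : ℂ)) * iteratedDeriv k riemannZeta₀ s := by
    have hd : ∀ k : ℕ, Continuous (iteratedDeriv k riemannZeta₀) := fun k =>
      (differentiable_riemannZeta₀.contDiff (n := k)).continuous_iteratedDeriv k le_rfl
    fun_prop
  have hval : (((-1 + ∑ k ∈ range (m + 1), stieltjes k / (Nat.factorial k : ℝ) : ℝ) : ℂ)) =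
      -1 + ∑ k ∈ range (m + 1),
        ((-1) ^ k / (Nat.factorial k : ℂ)) * iteratedDeriv k riemannZeta₀ 1 := by
    push_cast
    congr 1
    refine sum_congr rfl fun k _ => ?_
    rw [← iteratedDeriv_riemannZeta₀_one]
    ring
  rw [hval]
  refine ((hcont.tendsto 1).mono_left nhdsWithin_le_nhds).congr' ?_
  filter_upwards [self_mem_nhdsWithin] with s hs
  have hterm : ∀ k : ℕ, ((-s) ^ k / (Nat.factorial k : ℂ)) * iteratedDeriv k riemannZeta s =
      s ^ k / (s - 1) ^ (k + 1) +
        ((-s) ^ k / (Nat.factorial k : ℂ)) * iteratedDeriv k riemannZeta₀ s := by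
    intro k
    have hk : (Nat.factorial k : ℂ) ≠ 0 := Nat.cast_ne_zero.2 k.factorial_ne_zero
    have hpow : (-s) ^ k * (-1) ^ k = s ^ k := by rw [← mul_pow]; simp
    rw [iteratedDeriv_riemannZeta_eq k hs, mul_add, ← hpow]
    congr 1
    field_simp
  simp only [hterm, sum_add_distrib, sum_pow_div_sub_one_pow (m + 1) hs]
  ring
end

section
/- For every nonnegative integer m, every real x ≥ 1, and every complex number s with Re s > 1/2, the series ∑_{n=0}^{∞} L_n^{(m)}(log x) · ((s−1)/s)^n converges absolutely and its sum equals s^{m+1} / x^{s−1}. Moreover, for fixed real x > 1, the series ∑_{n=0}^{∞} L_n^{(m)}(log x) · ((s−1)/s)^n fails to converge absolutely when Re s ≤ 1/2 (and s ≠ 0). -/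
open Filter Finset MeasureTheory

/-- The associated Laguerre polynomial `L_n^{(m)}(u) = ∑_{k=0}^n C(n+m, n-k) (-1)^k u^k / k!`. -/
noncomputable def assocLaguerre (m n : ℕ) (u : ℝ) : ℝ :=
  ∑ k ∈ Finset.range (n + 1),
    ((n + m).choose (n - k) : ℝ) * (-1 : ℝ) ^ k * u ^ k / (Nat.factorial k : ℝ)

theorem hasSum_choose_mul_pow_mul {𝕜 : Type*} [RCLike 𝕜] (m k : ℕ) (w : 𝕜) {z : 𝕜}
    (hz : ‖z‖ < 1) :
    HasSum (fun j : ℕ => ((j + (k + m)).choose (k + m) : 𝕜) * z ^ j *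
        ((w * z) ^ k / (k.factorial : 𝕜)))
      ((1 / (1 - z)) ^ (m + 1) * ((w * z / (1 - z)) ^ k / (k.factorial : 𝕜))) := by
  have hne : 1 - z ≠ 0 := by
    intro h
    rw [← sub_eq_zero.mp h, norm_one] at hz
    exact lt_irrefl _ hz
  have hk : (k.factorial : 𝕜) ≠ 0 := Nat.cast_ne_zero.mpr k.factorial_ne_zero
  convert! (hasSum_choose_mul_geometric_of_norm_lt_one (k + m) hz).mul_right
    ((w * z) ^ k / (k.factorial : 𝕜)) using 1
  rw [div_pow, div_pow, one_pow]
  field_simp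
  ring

theorem summable_choose_mul_pow_mul (m : ℕ) (w : ℂ) {z : ℂ} (hz : ‖z‖ < 1) :
    Summable (fun p : ℕ × ℕ => ‖((p.2 + (p.1 + m)).choose (p.1 + m) : ℂ) * z ^ p.2 *
      ((w * z) ^ p.1 / (p.1.factorial : ℂ))‖) := by
  have hz' : ‖(‖z‖ : ℝ)‖ < 1 := by rwa [norm_norm]
  have key := fun k => hasSum_choose_mul_pow_mul m k ‖w‖ hz'
  rw [summable_prod_of_nonneg (fun _ => norm_nonneg _)]
  simp only [norm_mul, norm_div, norm_pow, Complex.norm_natCast]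
  refine ⟨fun k => (key k).summable, ?_⟩
  simp only [fun k => (key k).tsum_eq]
  exact (Real.summable_pow_div_factorial _).mul_left _

theorem sum_antidiagonal_eq_assocLaguerre_mul_pow (m n : ℕ) (u : ℝ) (z : ℂ) :
    ∑ p ∈ antidiagonal n, ((p.2 + (p.1 + m)).choose (p.1 + m) : ℂ) * z ^ p.2 *
      ((-(u : ℂ) * z) ^ p.1 / (p.1.factorial : ℂ)) = (assocLaguerre m n u : ℂ) * z ^ n := by
  rw [Finset.Nat.sum_antidiagonal_eq_sum_range_succ_mk, assocLaguerre, Complex.ofReal_sum,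
    Finset.sum_mul]
  refine Finset.sum_congr rfl fun k hk => ?_
  obtain ⟨j, rfl⟩ := Nat.exists_eq_add_of_le (Nat.lt_succ_iff.mp (Finset.mem_range.mp hk))
  have hc : (j + (k + m)).choose (k + m) = (k + j + m).choose j := by
    rw [show k + j + m = j + (k + m) by ring]
    exact (Nat.choose_symm_add).symm
  simp only [Nat.add_sub_cancel_left, hc]
  push_cast
  rw [mul_pow, neg_pow, pow_add]
  ring

/-- The generating function of the associated Laguerre polynomials, with absolute convergence. -/
theorem assocLaguerre_generating_function (m : ℕ) (u : ℝ) {z : ℂ} (hz : ‖z‖ < 1) :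
    Summable (fun n : ℕ => ‖(assocLaguerre m n u : ℂ) * z ^ n‖) ∧
      HasSum (fun n : ℕ => (assocLaguerre m n u : ℂ) * z ^ n)
        ((1 / (1 - z)) ^ (m + 1) * Complex.exp (-(u : ℂ) * z / (1 - z))) := by
  obtain ⟨f, hf⟩ : ∃ f : ℕ × ℕ → ℂ, ∀ p, f p = ((p.2 + (p.1 + m)).choose (p.1 + m) : ℂ) *
      z ^ p.2 * ((-(u : ℂ) * z) ^ p.1 / (p.1.factorial : ℂ)) := ⟨_, fun _ => rfl⟩
  have hnorm : Summable (fun p => ‖f p‖) := by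
    simpa only [hf] using summable_choose_mul_pow_mul m (-(u : ℂ)) hz
  have hanti : ∀ n, ∑ p ∈ antidiagonal n, f p = (assocLaguerre m n u : ℂ) * z ^ n := fun n => by
    simpa only [hf] using sum_antidiagonal_eq_assocLaguerre_mul_pow m n u z
  have hexp : HasSum (fun k : ℕ => (1 / (1 - z)) ^ (m + 1) *
      ((-(u : ℂ) * z / (1 - z)) ^ k / (k.factorial : ℂ)))
      ((1 / (1 - z)) ^ (m + 1) * Complex.exp (-(u : ℂ) * z / (1 - z))) := by
    rw [Complex.exp_eq_exp_ℂ]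
    exact HasSum.mul_left _
      (NormedSpace.expSeries_div_hasSum_exp (-(u : ℂ) * z / (1 - z)))
  have htot : HasSum f
      ((1 / (1 - z)) ^ (m + 1) * Complex.exp (-(u : ℂ) * z / (1 - z))) := by
    have h := hnorm.of_norm.hasSum
    have h' := h.prod_fiberwise fun k => by
      simpa only [hf] using hasSum_choose_mul_pow_mul m k (-(u : ℂ)) hz
    rwa [h'.unique hexp] at h
  constructor
  · have h := (Finset.HasAntidiagonal.sigmaAntidiagonalEquivProd (A := ℕ)).summable_iff.mpr hnorm
    refine Summable.of_nonneg_of_le (fun _ => norm_nonneg _) (fun n => ?_) h.sigma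
    rw [tsum_fintype, ← hanti n]
    refine (norm_sum_le _ _).trans (le_of_eq ?_)
    exact (Finset.sum_coe_sort (antidiagonal n) fun p => ‖f p‖).symm
  · have h := (Finset.HasAntidiagonal.sigmaAntidiagonalEquivProd (A := ℕ)).hasSum_iff.mpr htot
    refine h.sigma fun n => ?_
    rw [← hanti n, ← Finset.sum_coe_sort (antidiagonal n) f]
    exact hasSum_fintype _

theorem norm_sub_one_sq (s : ℂ) : ‖s - 1‖ ^ 2 = ‖s‖ ^ 2 + (1 - 2 * s.re) := by
  rw [Complex.sq_norm, Complex.sq_norm, Complex.normSq_apply, Complex.normSq_apply]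
  simp only [Complex.sub_re, Complex.sub_im, Complex.one_re, Complex.one_im]
  ring

theorem norm_sub_one_div_lt_one {s : ℂ} (hs : 1 / 2 < s.re) : ‖(s - 1) / s‖ < 1 := by
  have h0 : s ≠ 0 := by
    rintro rfl
    norm_num at hs
  rw [norm_div, div_lt_one (norm_pos_iff.mpr h0)]
  refine lt_of_pow_lt_pow_left₀ 2 (norm_nonneg _) ?_
  rw [norm_sub_one_sq]
  linarith

theorem one_le_norm_sub_one_div {s : ℂ} (hs : s.re ≤ 1 / 2) (h0 : s ≠ 0) :
    1 ≤ ‖(s - 1) / s‖ := by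
  rw [norm_div, one_le_div (norm_pos_iff.mpr h0)]
  refine le_of_sq_le_sq ?_ (norm_nonneg _)
  rw [norm_sub_one_sq]
  linarith

theorem hasSum_assocLaguerre_log (m : ℕ) {x : ℝ} (hx : 0 < x) {s : ℂ} (hs : 1 / 2 < s.re) :
    HasSum (fun n : ℕ => (assocLaguerre m n (Real.log x) : ℂ) * ((s - 1) / s) ^ n)
      (s ^ (m + 1) / (x : ℂ) ^ (s - 1)) := by
  have h0 : s ≠ 0 := by
    rintro rfl
    norm_num at hs
  convert! (assocLaguerre_generating_function m (Real.log x)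
    (norm_sub_one_div_lt_one hs)).2 using 1
  have h1 : 1 - (s - 1) / s = 1 / s := by
    field_simp
    ring
  rw [h1, one_div_one_div, Complex.cpow_def_of_ne_zero (Complex.ofReal_ne_zero.mpr hx.ne'),
    div_eq_mul_inv, ← Complex.exp_neg, ← Complex.ofReal_log hx.le]
  congr 2
  field_simp

theorem not_summable_norm_assocLaguerre_log (m : ℕ) {x : ℝ} (hx : 0 < x) :
    ¬ Summable (fun n : ℕ => ‖(assocLaguerre m n (Real.log x) : ℂ)‖) := by
  intro hsum
  obtain ⟨N, hN⟩ := exists_nat_gt (∑' n : ℕ, ‖(assocLaguerre m n (Real.log x) : ℂ)‖)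
  set s : ℂ := ⟨1, N⟩ with hs
  have hre : 1 / 2 < s.re := by norm_num [hs]
  have hle : ‖s ^ (m + 1) / (x : ℂ) ^ (s - 1)‖ ≤
      ∑' n : ℕ, ‖(assocLaguerre m n (Real.log x) : ℂ)‖ := by
    rw [← (hasSum_assocLaguerre_log m hx hre).tsum_eq]
    refine tsum_of_norm_bounded hsum.hasSum fun n => ?_
    rw [norm_mul, norm_pow]
    exact mul_le_of_le_one_right (norm_nonneg _)
      (pow_le_one₀ (norm_nonneg _) (norm_sub_one_div_lt_one hre).le)
  have hone : 1 ≤ ‖s‖ := by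
    simpa [hs] using Complex.abs_re_le_norm s
  have hNs : (N : ℝ) ≤ ‖s‖ := by
    simpa [hs] using Complex.abs_im_le_norm s
  rw [norm_div, Complex.norm_cpow_eq_rpow_re_of_pos hx, Complex.sub_re, Complex.one_re, norm_pow,
    show s.re - 1 = 0 by simp [hs], Real.rpow_zero, div_one] at hle
  linarith [le_self_pow₀ hone (Nat.add_one_ne_zero m)]

theorem statement12 (m : ℕ) :
    (∀ x : ℝ, 1 ≤ x → ∀ s : ℂ, 1 / 2 < s.re →
      Summable (fun n : ℕ =>
        ‖((assocLaguerre m n (Real.log x) : ℝ) : ℂ) * ((s - 1) / s) ^ n‖) ∧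
      ∑' n : ℕ, ((assocLaguerre m n (Real.log x) : ℝ) : ℂ) * ((s - 1) / s) ^ n =
        s ^ (m + 1) / (x : ℂ) ^ (s - 1)) ∧
    (∀ x : ℝ, 1 < x → ∀ s : ℂ, s.re ≤ 1 / 2 → s ≠ 0 →
      ¬ Summable (fun n : ℕ =>
        ‖((assocLaguerre m n (Real.log x) : ℝ) : ℂ) * ((s - 1) / s) ^ n‖)) := by
  refine ⟨fun x hx s hs => ⟨?_, ?_⟩, fun x hx s hs h0 hsum => ?_⟩
  · exact (assocLaguerre_generating_function m (Real.log x) (norm_sub_one_div_lt_one hs)).1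
  · exact (hasSum_assocLaguerre_log m (by linarith) hs).tsum_eq
  · refine not_summable_norm_assocLaguerre_log m (x := x) (by linarith)
      (Summable.of_nonneg_of_le (fun _ => norm_nonneg _) (fun n => ?_) hsum)
    rw [norm_mul, norm_pow]
    exact le_mul_of_one_le_right (norm_nonneg _) (one_le_pow₀ (one_le_norm_sub_one_div hs h0))
end

section
/- For every complex number s with Re s > 1/2 and s ≠ 1, ζ(s) = s/(s−1) + ∑_{n=0}^{∞} ℓ_n · ((1−s)/s)^n, where the series converges. -/
open Filter Finset MeasureTheory

/-- The Fourier coefficients `ℓ_n`: `ℓ_0 = γ_0 - 1` and, for `n ≥ 1`,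
`ℓ_n = ∑_{k=1}^n C(n-1,k-1) (-1)^{n-k} γ_k / k!`. -/
noncomputable def ellSeq (n : ℕ) : ℝ :=
  if n = 0 then stieltjes 0 - 1
  else ∑ k ∈ Finset.Icc 1 n,
    ((n - 1).choose (k - 1) : ℝ) * (-1 : ℝ) ^ (n - k) * stieltjes k / (Nat.factorial k : ℝ)

/-- Substituting `w / (1 + w)` into a power series with infinite radius of convergence. -/
theorem hasSum_comp_div_one_add {a : ℕ → ℂ} (ha : ∀ r : ℝ, 0 ≤ r → Summable fun k => ‖a k‖ * r ^ k)
    {w : ℂ} (hw : ‖w‖ < 1) :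
    HasSum (fun n : ℕ => (∑ p ∈ antidiagonal n,
        ((n.choose p.1 : ℂ) * (-1) ^ p.2 * a (p.1 + 1))) * w ^ (n + 1))
      (∑' k, a (k + 1) * (w / (1 + w)) ^ (k + 1)) := by
  have hnw : ‖-w‖ < 1 := by simpa using hw
  set f : ℕ × ℕ → ℂ := fun p =>
    a (p.1 + 1) * w ^ (p.1 + 1) * (((p.2 + p.1).choose p.1 : ℂ) * (-w) ^ p.2) with hf
  have hrow (j : ℕ) : HasSum (fun m => f (j, m)) (a (j + 1) * (w / (1 + w)) ^ (j + 1)) := by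
    have h := (hasSum_choose_mul_geometric_of_norm_lt_one j hnw).mul_left (a (j + 1) * w ^ (j + 1))
    rw [sub_neg_eq_add] at h
    convert! h using 1
    rw [div_pow]
    ring
  have hnorm (j : ℕ) : HasSum (fun m => ‖f (j, m)‖)
      (‖a (j + 1)‖ * (‖w‖ / (1 - ‖w‖)) ^ (j + 1)) := by
    have h := (hasSum_choose_mul_geometric_of_norm_lt_one j
      (show ‖‖w‖‖ < 1 by simpa using hw)).mul_left (‖a (j + 1)‖ * ‖w‖ ^ (j + 1))
    have e : ‖a (j + 1)‖ * (‖w‖ / (1 - ‖w‖)) ^ (j + 1) =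
        ‖a (j + 1)‖ * ‖w‖ ^ (j + 1) * (1 / (1 - ‖w‖) ^ (j + 1)) := by
      rw [div_pow]
      ring
    rw [e]
    exact h.congr_fun fun m => by simp [hf]
  have hsum : Summable f := by
    apply Summable.of_norm
    rw [summable_prod_of_nonneg fun _ => norm_nonneg _]
    refine ⟨fun j => (hnorm j).summable, ?_⟩
    simp_rw [fun j => (hnorm j).tsum_eq]
    exact (summable_nat_add_iff 1).2 (ha _ (div_nonneg (norm_nonneg _) (by linarith)))
  have htot : HasSum f (∑' k, a (k + 1) * (w / (1 + w)) ^ (k + 1)) := by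
    have h := hsum.hasSum
    rwa [(h.prod_fiberwise hrow).tsum_eq]
  have h2 := (HasAntidiagonal.sigmaAntidiagonalEquivProd.hasSum_iff.2 htot).sigma
    fun n => (hasSum_fintype _)
  refine h2.congr_fun fun n => ?_
  rw [← sum_coe_sort, sum_mul]
  refine sum_congr rfl fun p _ => ?_
  obtain ⟨⟨i, j⟩, hp⟩ := p
  rw [HasAntidiagonal.mem_antidiagonal] at hp
  subst hp
  simp only [Function.comp_apply, HasAntidiagonal.sigmaAntidiagonalEquivProd_apply, hf]
  rw [neg_pow w, add_comm j i]
  ring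

/-- The difference between the partial sum of `(-log k) ^ n * k ^ (-s)` up to `N + 1` and the
corresponding integral. -/
noncomputable def zetaDefect (N n : ℕ) (s : ℂ) : ℂ :=
  ∑ k ∈ range (N + 1), (-(Real.log (k + 1) : ℂ)) ^ n * ((k + 1 : ℝ) : ℂ) ^ (-s) -
    ∫ x in (1 : ℝ)..(N + 1 : ℝ), (-(Real.log x : ℂ)) ^ n * (x : ℂ) ^ (-s)

theorem hasDerivAt_neg_log_pow_mul_cpow (n : ℕ) {x : ℝ} (hx : 0 < x) (s : ℂ) :
    HasDerivAt (fun s : ℂ => (-(Real.log x : ℂ)) ^ n * (x : ℂ) ^ (-s))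
      ((-(Real.log x : ℂ)) ^ (n + 1) * (x : ℂ) ^ (-s)) s := by
  have h := (((hasDerivAt_id s).neg).const_cpow (c := (x : ℂ))
    (Or.inl (by exact_mod_cast hx.ne'))).const_mul ((-(Real.log x : ℂ)) ^ n)
  refine h.congr_deriv ?_
  rw [← Complex.ofReal_log hx.le, pow_succ]
  simp
  ring

theorem continuousOn_neg_log_pow_mul_cpow (n : ℕ) (s : ℂ) :
    ContinuousOn (fun x : ℝ => (-(Real.log x : ℂ)) ^ n * (x : ℂ) ^ (-s)) (Set.Ioi 0) := by
  intro x (hx : 0 < x)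
  have h1 : ContinuousAt Real.log x := Real.continuousAt_log hx.ne'
  have h2 : ContinuousAt (fun x : ℝ => (x : ℂ) ^ (-s)) x :=
    Complex.continuousAt_ofReal_cpow_const _ _ (Or.inr hx.ne')
  exact (((Complex.continuous_ofReal.continuousAt.comp h1).neg.pow n).mul h2).continuousWithinAt

theorem hasDerivAt_integral_neg_log_pow_mul_cpow (n : ℕ) {b : ℝ} (hb : 1 ≤ b) (s : ℂ) :
    HasDerivAt (fun s : ℂ => ∫ x in (1 : ℝ)..b, (-(Real.log x : ℂ)) ^ n * (x : ℂ) ^ (-s))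
      (∫ x in (1 : ℝ)..b, (-(Real.log x : ℂ)) ^ (n + 1) * (x : ℂ) ^ (-s)) s := by
  have hsub : Set.uIcc 1 b ⊆ Set.Ioi 0 := by
    rw [Set.uIcc_of_le hb]
    exact fun x hx => lt_of_lt_of_le one_pos hx.1
  have hint (m : ℕ) (z : ℂ) : IntervalIntegrable
      (fun x : ℝ => (-(Real.log x : ℂ)) ^ m * (x : ℂ) ^ (-z)) volume 1 b :=
    ((continuousOn_neg_log_pow_mul_cpow m z).mono hsub).intervalIntegrable
  have hΙ {t : ℝ} (ht : t ∈ Set.uIoc 1 b) : 1 < t := by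
    rw [Set.uIoc_of_le hb] at ht
    exact ht.1
  refine (intervalIntegral.hasDerivAt_integral_of_dominated_loc_of_deriv_le
    (F := fun z x => (-(Real.log x : ℂ)) ^ n * (x : ℂ) ^ (-z))
    (F' := fun z x => (-(Real.log x : ℂ)) ^ (n + 1) * (x : ℂ) ^ (-z))
    (bound := fun x => ‖(-(Real.log x : ℂ)) ^ (n + 1) * (x : ℂ) ^ (-(s - 1))‖)
    (Metric.ball_mem_nhds s one_pos) (.of_forall fun z => ?_) (hint n s) ?_ ?_
    (hint (n + 1) (s - 1)).norm ?_).2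
  · exact (intervalIntegrable_iff.1 (hint n z)).aestronglyMeasurable
  · exact (intervalIntegrable_iff.1 (hint (n + 1) s)).aestronglyMeasurable
  · refine .of_forall fun t ht z hz => ?_
    have h1 := hΙ ht
    rw [norm_mul, norm_mul, Complex.norm_cpow_eq_rpow_re_of_pos (by linarith),
      Complex.norm_cpow_eq_rpow_re_of_pos (by linarith)]
    refine mul_le_mul_of_nonneg_left (Real.rpow_le_rpow_of_exponent_le h1.le ?_) (norm_nonneg _)
    have h2 := (Complex.abs_re_le_norm (z - s)).trans_lt (mem_ball_iff_norm.1 hz)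
    rw [abs_lt] at h2
    simp only [Complex.sub_re, Complex.neg_re, Complex.one_re] at h2 ⊢
    linarith
  · refine .of_forall fun t ht z _ => ?_
    exact hasDerivAt_neg_log_pow_mul_cpow n (by linarith [hΙ ht]) z

theorem hasDerivAt_zetaDefect (N n : ℕ) (s : ℂ) :
    HasDerivAt (zetaDefect N n) (zetaDefect N (n + 1) s) s := by
  refine .sub (.fun_sum fun k _ => ?_)
    (hasDerivAt_integral_neg_log_pow_mul_cpow n (by simp) s)
  exact hasDerivAt_neg_log_pow_mul_cpow n (by positivity) s

theorem iteratedDeriv_zetaDefect (N n : ℕ) :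
    iteratedDeriv n (zetaDefect N 0) = zetaDefect N n := by
  induction n with
  | zero => simp
  | succ n ih =>
    rw [iteratedDeriv_succ, ih]
    exact funext fun s => (hasDerivAt_zetaDefect N n s).deriv

theorem zetaDefect_one (N n : ℕ) :
    zetaDefect N n 1 = (-1) ^ n * (((∑ k ∈ range (N + 1), Real.log ((k : ℝ) + 1) ^ n / ((k : ℝ) + 1))
      - Real.log ((N + 1 : ℕ) : ℝ) ^ (n + 1) / ((n : ℝ) + 1) : ℝ) : ℂ) := by
  have h1 : (1 : ℝ) ≤ N + 1 := by simp
  have hint : ∫ x in (1 : ℝ)..(N + 1 : ℝ), Real.log x ^ n / x =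
      Real.log ((N + 1 : ℕ) : ℝ) ^ (n + 1) / ((n : ℝ) + 1) := by
    have hpos : ∀ x ∈ Set.uIcc (1 : ℝ) (N + 1), 0 < x := by
      rw [Set.uIcc_of_le h1]
      exact fun x hx => lt_of_lt_of_le one_pos hx.1
    rw [intervalIntegral.integral_eq_sub_of_hasDerivAt
      (f := fun x => Real.log x ^ (n + 1) / ((n : ℝ) + 1))]
    · simp
    · intro x hx
      have h := ((Real.hasDerivAt_log (hpos x hx).ne').pow (n + 1)).div_const ((n : ℝ) + 1)
      refine h.congr_deriv ?_
      have : (n : ℝ) + 1 ≠ 0 := by positivity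
      have := (hpos x hx).ne'
      push_cast
      field_simp
    · refine ContinuousOn.intervalIntegrable fun x hx => ?_
      have := (hpos x hx).ne'
      exact (((Real.continuousAt_log this).pow n).div continuousAt_id this).continuousWithinAt
  rw [← hint, zetaDefect, Complex.ofReal_sub, mul_sub, ← intervalIntegral.integral_ofReal,
    ← intervalIntegral.integral_const_mul, Complex.ofReal_sum, mul_sum]
  congr 1
  · refine sum_congr rfl fun k _ => ?_
    rw [neg_pow, Complex.cpow_neg_one]
    push_cast
    ring
  · congr 1
    ext x
    rw [neg_pow, Complex.cpow_neg_one]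
    push_cast
    ring

/-- The increments of `zetaDefect N 0`. -/
noncomputable def zetaDefectIncr (k : ℕ) (s : ℂ) : ℂ :=
  ∫ x in (k + 1 : ℝ)..(k + 2 : ℝ), (((k + 2 : ℝ) : ℂ) ^ (-s) - (x : ℂ) ^ (-s))

theorem zetaDefect_zero_eq_sum (N : ℕ) (s : ℂ) :
    zetaDefect N 0 s = 1 + ∑ k ∈ range N, zetaDefectIncr k s := by
  have hi {a b : ℝ} (ha : 0 < a) (hb : 0 < b) :
      IntervalIntegrable (fun x : ℝ => (x : ℂ) ^ (-s)) volume a b := by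
    apply ContinuousOn.intervalIntegrable
    refine ((continuousOn_neg_log_pow_mul_cpow 0 s).mono ?_).congr fun x _ => by simp
    exact fun x hx => lt_of_lt_of_le (lt_min ha hb) hx.1
  induction N with
  | zero => simp [zetaDefect]
  | succ N ih =>
    rw [sum_range_succ, ← add_assoc, ← ih, zetaDefect, zetaDefect, sum_range_succ _ (N + 1),
      zetaDefectIncr, intervalIntegral.integral_sub (by simp) (hi (by positivity) (by positivity))]
    simp only [pow_zero, one_mul]
    have h := intervalIntegral.integral_add_adjacent_intervals
      (hi one_pos (by positivity : (0 : ℝ) < N + 1))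
      (hi (by positivity : (0 : ℝ) < N + 1) (by positivity : (0 : ℝ) < N + 2))
    have h3 : ((N + 1 : ℕ) : ℝ) + 1 = N + 2 := by push_cast; ring
    rw [h3, ← h]
    simp
    ring

theorem norm_zetaDefectIncr_le (k : ℕ) {s : ℂ} (hs : s ∈ Metric.ball (2 : ℂ) (3 / 2)) :
    ‖zetaDefectIncr k s‖ ≤ 4 * (1 / ((k + 1 : ℕ) : ℝ) ^ (3 / 2 : ℝ)) := by
  have hs' := mem_ball_iff_norm.1 hs
  have hns : ‖s‖ ≤ 4 := by
    have := norm_add_le (s - 2) 2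
    simp at this
    linarith
  have hre : 1 / 2 < s.re := by
    have := (Complex.abs_re_le_norm (s - 2)).trans_lt hs'
    rw [abs_lt] at this
    simp at this
    linarith
  have hk : (0 : ℝ) < k + 1 := by positivity
  have hderiv (x : ℝ) (hx : x ∈ Set.Icc (k + 1 : ℝ) (k + 2)) :
      HasDerivWithinAt (fun x : ℝ => (x : ℂ) ^ (-s)) (-s * (x : ℂ) ^ (-s - 1))
        (Set.Icc (k + 1 : ℝ) (k + 2)) x := by
    have hx0 : 0 < x := hk.trans_le hx.1
    have h := ((hasDerivAt_id (x : ℂ)).cpow_const (c := -s) (Or.inl (by simpa using hx0)))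
    exact (h.comp_ofReal.congr_deriv (by simp)).hasDerivWithinAt
  have hbound (x : ℝ) (hx : x ∈ Set.Icc (k + 1 : ℝ) (k + 2)) :
      ‖-s * (x : ℂ) ^ (-s - 1)‖ ≤ 4 * (1 / ((k + 1 : ℕ) : ℝ) ^ (3 / 2 : ℝ)) := by
    have hx0 : 0 < x := hk.trans_le hx.1
    rw [norm_mul, norm_neg, Complex.norm_cpow_eq_rpow_re_of_pos hx0, one_div,
      ← Real.rpow_neg (by positivity)]
    refine mul_le_mul hns ?_ (by positivity) (by norm_num)
    calc x ^ (-s - 1).re ≤ x ^ (-(3 / 2) : ℝ) := by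
          apply Real.rpow_le_rpow_of_exponent_le
          · linarith [hx.1, (Nat.cast_nonneg k : (0 : ℝ) ≤ k)]
          · simp
            linarith
      _ ≤ _ := by
          apply Real.rpow_le_rpow_of_nonpos (by positivity) (by push_cast; exact hx.1) (by norm_num)
  rw [zetaDefectIncr]
  refine (intervalIntegral.norm_integral_le_of_norm_le_const
    (C := 4 * (1 / ((k + 1 : ℕ) : ℝ) ^ (3 / 2 : ℝ))) fun x hx => ?_).trans (by norm_num)
  rw [Set.uIoc_of_le (by linarith)] at hx
  have h := (convex_Icc (k + 1 : ℝ) (k + 2)).norm_image_sub_le_of_norm_hasDerivWithin_le hderiv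
    hbound (Set.Ioc_subset_Icc_self hx) (Set.right_mem_Icc.2 (by linarith))
  refine (h.trans (mul_le_of_le_one_right (by positivity) ?_))
  rw [Real.norm_eq_abs, abs_le]
  constructor <;> linarith [hx.1, hx.2]

theorem tendsto_zetaDefect_zero {s : ℂ} (hs : 1 < s.re) :
    Tendsto (fun N => zetaDefect N 0 s) atTop (nhds (riemannZeta₀ s)) := by
  have hs1 : s ≠ 1 := by
    rintro rfl
    simp at hs
  have hs1' : s - 1 ≠ 0 := sub_ne_zero.2 hs1
  have hsum : Tendsto (fun N : ℕ => ∑ k ∈ range N, 1 / (k + 1 : ℂ) ^ s) atTop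
      (nhds (riemannZeta s)) := by
    rw [zeta_eq_tsum_one_div_nat_add_one_cpow hs]
    refine Summable.hasSum ?_ |>.tendsto_sum_nat
    have := (summable_nat_add_iff 1).2 (Complex.summable_one_div_nat_cpow.2 hs)
    simpa using this
  have hpow : Tendsto (fun N : ℕ => ((N + 1 : ℝ) : ℂ) ^ (-s + 1)) atTop (nhds 0) := by
    rw [tendsto_zero_iff_norm_tendsto_zero]
    have : Tendsto (fun N : ℕ => (N + 1 : ℝ) ^ (-(s.re - 1))) atTop (nhds 0) :=
      (tendsto_rpow_neg_atTop (by linarith)).comp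
        (tendsto_atTop_add_const_right _ 1 tendsto_natCast_atTop_atTop)
    refine this.congr fun N => ?_
    rw [Complex.norm_cpow_eq_rpow_re_of_pos (by positivity)]
    simp
    ring_nf
  have hlim : riemannZeta₀ s = riemannZeta s - (0 - 1) / (-s + 1) := by
    rw [riemannZeta_eq_inv_sub_add hs1]
    have : -s + 1 ≠ 0 := fun h => hs1' (by linear_combination -h)
    field_simp
    ring
  rw [hlim]
  refine ((hsum.comp (tendsto_add_atTop_nat 1)).sub ((hpow.sub_const 1).div_const _)).congr
    fun N => ?_
  rw [zetaDefect]
  simp only [pow_zero, one_mul]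
  rw [integral_cpow]
  · simp [Complex.cpow_neg]
  · right
    refine ⟨fun h => hs1 (by simpa using h), ?_⟩
    rw [Set.uIcc_of_le (by simp)]
    exact fun h => absurd h.1 (by norm_num)

theorem tendstoUniformlyOn_zetaDefect_zero :
    TendstoUniformlyOn (fun N => zetaDefect N 0) riemannZeta₀ atTop
      (Metric.ball (2 : ℂ) (3 / 2)) := by
  have hsummable : Summable fun k : ℕ => 4 * (1 / ((k + 1 : ℕ) : ℝ) ^ (3 / 2 : ℝ)) :=
    ((summable_nat_add_iff 1).2 (Real.summable_one_div_nat_rpow.2 (by norm_num))).mul_left 4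
  set G : ℂ → ℂ := fun s => 1 + ∑' k, zetaDefectIncr k s with hG
  have hunif : TendstoUniformlyOn (fun N => zetaDefect N 0) G atTop
      (Metric.ball (2 : ℂ) (3 / 2)) := by
    have h := tendstoUniformlyOn_tsum_nat hsummable
      fun k s hs => norm_zetaDefectIncr_le k hs
    rw [Metric.tendstoUniformlyOn_iff] at h ⊢
    simpa only [zetaDefect_zero_eq_sum, hG, dist_add_left] using h
  have hGd : DifferentiableOn ℂ G (Metric.ball (2 : ℂ) (3 / 2)) :=
    hunif.tendstoLocallyUniformlyOn.differentiableOn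
      (.of_forall fun N s _ => (hasDerivAt_zetaDefect N 0 s).differentiableAt.differentiableWithinAt)
      Metric.isOpen_ball
  have hmem : (2 : ℂ) ∈ Metric.ball (2 : ℂ) (3 / 2) := Metric.mem_ball_self (by norm_num)
  refine hunif.congr_right ?_
  refine (hGd.analyticOnNhd Metric.isOpen_ball).eqOn_of_preconnected_of_eventuallyEq
    (differentiable_riemannZeta₀.differentiableOn.analyticOnNhd Metric.isOpen_ball)
    (convex_ball _ _).isPreconnected hmem ?_
  have hre : ∀ᶠ s : ℂ in nhds 2, 1 < s.re :=
    Complex.continuous_re.continuousAt.eventually_const_lt (by norm_num)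
  filter_upwards [hre, Metric.isOpen_ball.mem_nhds hmem] with s hs hs2
  exact tendsto_nhds_unique (hunif.tendsto_at hs2) (tendsto_zetaDefect_zero hs)

theorem tendsto_zetaDefect_one (n : ℕ) :
    Tendsto (fun N => zetaDefect N n 1) atTop (nhds (iteratedDeriv n riemannZeta₀ 1)) := by
  have hmem : (1 : ℂ) ∈ Metric.ball (2 : ℂ) (3 / 2) := by
    rw [mem_ball_iff_norm]
    norm_num
  have h : TendstoLocallyUniformlyOn (fun N => zetaDefect N n) (iteratedDeriv n riemannZeta₀) atTop
      (Metric.ball (2 : ℂ) (3 / 2)) := by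
    induction n with
    | zero => simpa using tendstoUniformlyOn_zetaDefect_zero.tendstoLocallyUniformlyOn
    | succ n ih =>
      rw [iteratedDeriv_succ]
      have h := ih.deriv (.of_forall fun N s _ =>
        (hasDerivAt_zetaDefect N n s).differentiableAt.differentiableWithinAt) Metric.isOpen_ball
      refine h.congr fun N s _ => (hasDerivAt_zetaDefect N n s).deriv
  exact h.tendsto_at hmem

/-- The Stieltjes constants are, up to sign, the derivatives of `riemannZeta₀` at `1`. -/
theorem stieltjes_eq_iteratedDeriv (n : ℕ) :
    (stieltjes n : ℂ) = (-1) ^ n * iteratedDeriv n riemannZeta₀ 1 := by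
  set u : ℕ → ℝ := fun N => (∑ k ∈ range N, Real.log ((k : ℝ) + 1) ^ n / ((k : ℝ) + 1)) -
      Real.log (N : ℝ) ^ (n + 1) / ((n : ℝ) + 1) with hu
  have hsq : ((-1 : ℂ) ^ n) * (-1) ^ n = 1 := by
    rw [← mul_pow]
    simp
  have hC : Tendsto (fun N => (u N : ℂ)) atTop
      (nhds ((-1) ^ n * iteratedDeriv n riemannZeta₀ 1)) := by
    rw [← tendsto_add_atTop_iff_nat 1]
    refine ((tendsto_zetaDefect_one n).const_mul ((-1) ^ n)).congr fun N => ?_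
    rw [zetaDefect_one, ← mul_assoc, hsq, one_mul]
  have hR : Tendsto u atTop (nhds (((-1) ^ n * iteratedDeriv n riemannZeta₀ 1).re)) :=
    (Complex.continuous_re.tendsto _).comp hC
  have hlim : stieltjes n = ((-1) ^ n * iteratedDeriv n riemannZeta₀ 1).re := hR.limUnder_eq
  rw [hlim]
  exact tendsto_nhds_unique ((Complex.continuous_ofReal.tendsto _).comp hR) hC

theorem hasSum_stieltjes (s : ℂ) :
    HasSum (fun n : ℕ => (stieltjes n : ℂ) / (n.factorial : ℂ) * (1 - s) ^ n) (riemannZeta₀ s) := by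
  refine (Complex.hasSum_taylorSeries_of_entire differentiable_riemannZeta₀ 1 s).congr_fun
    fun n => ?_
  rw [stieltjes_eq_iteratedDeriv, ← neg_sub s 1, neg_pow (s - 1), smul_eq_mul, smul_eq_mul]
  have hsq : ((-1 : ℂ) ^ n) * (-1) ^ n = 1 := by
    rw [← mul_pow]
    simp
  linear_combination (iteratedDeriv n riemannZeta₀ 1 / (n.factorial : ℂ) * (s - 1) ^ n) * hsq

theorem ellSeq_succ (n : ℕ) :
    (ellSeq (n + 1) : ℂ) = ∑ p ∈ antidiagonal n, ((n.choose p.1 : ℂ) * (-1) ^ p.2 *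
      ((stieltjes (p.1 + 1) : ℂ) / ((p.1 + 1).factorial : ℂ))) := by
  rw [ellSeq, if_neg n.succ_ne_zero, Nat.sum_antidiagonal_eq_sum_range_succ
    (fun i j => (n.choose i : ℂ) * (-1) ^ j * ((stieltjes (i + 1) : ℂ) / ((i + 1).factorial : ℂ))),
    ← Ico_add_one_right_eq_Icc, sum_Ico_eq_sum_range, Complex.ofReal_sum]
  refine sum_congr rfl fun k _ => ?_
  rw [Nat.add_sub_cancel_left, Nat.add_sub_cancel, add_comm 1 k, Nat.add_sub_add_right,
    mul_div_assoc]
  push_cast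
  rfl

theorem statement13 (s : ℂ) (hs : 1 / 2 < s.re) (hs1 : s ≠ 1) :
    Summable (fun n : ℕ => ((ellSeq n : ℝ) : ℂ) * ((1 - s) / s) ^ n) ∧
    riemannZeta s = s / (s - 1) + ∑' n : ℕ, ((ellSeq n : ℝ) : ℂ) * ((1 - s) / s) ^ n := by
  have hs0 : s ≠ 0 := by
    rintro rfl
    norm_num at hs
  have hs1' : s - 1 ≠ 0 := sub_ne_zero.2 hs1
  have hw : ‖(1 - s) / s‖ < 1 := by
    rw [norm_div, div_lt_one (norm_pos_iff.2 hs0), ← sq_lt_sq₀ (norm_nonneg _) (norm_nonneg _),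
      ← Complex.normSq_eq_norm_sq, ← Complex.normSq_eq_norm_sq, Complex.normSq_apply,
      Complex.normSq_apply]
    simp
    nlinarith
  have hsub : (1 - s) / s / (1 + (1 - s) / s) = 1 - s := by
    field_simp
    simp
  have ha (r : ℝ) (hr : 0 ≤ r) :
      Summable fun k => ‖(stieltjes k : ℂ) / (k.factorial : ℂ)‖ * r ^ k := by
    refine (hasSum_stieltjes (1 - r)).summable.norm.congr fun k => ?_
    rw [norm_mul, norm_pow, sub_sub_cancel, Complex.norm_real, Real.norm_of_nonneg hr]
  have h := hasSum_comp_div_one_add ha hw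
  rw [hsub] at h
  have hz := hasSum_stieltjes s
  rw [(hasSum_nat_add_iff' 1).2 hz |>.tsum_eq] at h
  simp_rw [← ellSeq_succ] at h
  have hsum : HasSum (fun n : ℕ => (ellSeq n : ℂ) * ((1 - s) / s) ^ n) (riemannZeta₀ s - 1) := by
    rw [← hasSum_nat_add_iff' 1]
    convert! h using 1
    simp [ellSeq]
  refine ⟨hsum.summable, ?_⟩
  rw [hsum.tsum_eq, riemannZeta_eq_inv_sub_add hs1]
  field_simp
  ring
end

section
/- Fix a nonnegative integer m and let F_m(z) = ∑_{n=0}^{∞} (ℓ_n^{(m)}/n!) z^n and G_m(z) = ∑_{n=0}^{∞} (ℓ_0^{(m+n)}/n!) z^n, where ℓ_0^{(j)} := −1 + ∑_{i=0}^{j} γ_i / i!. Then for every complex number z with |z| < 1, both series converge and F_m(z) = G_m(z) · e^{−z}. -/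
open Filter Finset MeasureTheory

/-- `ℓ_0^{(j)} = -1 + ∑_{i=0}^j γ_i / i!`. -/
noncomputable def ellZero (j : ℕ) : ℝ :=
  -1 + ∑ i ∈ Finset.range (j + 1), stieltjes i / (Nat.factorial i : ℝ)

/-- The difference between consecutive terms of the sequence defining `γ_n`. -/
noncomputable def stieltjesIncrement (n i : ℕ) : ℝ :=
  Real.log ((i : ℝ) + 1) ^ n / ((i : ℝ) + 1) -
    (Real.log ((i : ℝ) + 1) ^ (n + 1) / ((n : ℝ) + 1) -
      Real.log (i : ℝ) ^ (n + 1) / ((n : ℝ) + 1))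

theorem sum_stieltjesIncrement (n N : ℕ) :
    ∑ i ∈ Finset.range N, stieltjesIncrement n i =
      (∑ k ∈ Finset.range N, Real.log ((k : ℝ) + 1) ^ n / ((k : ℝ) + 1)) -
        Real.log (N : ℝ) ^ (n + 1) / ((n : ℝ) + 1) := by
  have h := Finset.sum_range_sub (fun i : ℕ => Real.log (i : ℝ) ^ (n + 1) / ((n : ℝ) + 1)) N
  simp only [Nat.cast_add, Nat.cast_one, Nat.cast_zero, Real.log_zero] at h
  simp only [stieltjesIncrement, Finset.sum_sub_distrib (f := fun i : ℕ =>
    Real.log ((i : ℝ) + 1) ^ n / ((i : ℝ) + 1)), h]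
  simp

theorem log_pow_le_factorial_mul_rpow (n : ℕ) {d : ℝ} (hd : 1 ≤ d) :
    Real.log d ^ n ≤ n.factorial * 2 ^ n * d ^ (1 / 2 : ℝ) := by
  have h := Real.pow_div_factorial_le_exp (Real.log d / 2)
    (div_nonneg (Real.log_nonneg hd) zero_le_two) n
  have he : Real.exp (Real.log d / 2) = d ^ (1 / 2 : ℝ) := by
    rw [Real.rpow_def_of_pos (by linarith)]; congr 1; ring
  rw [he, div_pow, div_div, div_le_iff₀ (by positivity)] at h
  linarith

theorem natCast_mul_log_pow_pred_le (n : ℕ) {d : ℝ} (hd : 1 ≤ d) :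
    (n : ℝ) * Real.log d ^ (n - 1) ≤ n.factorial * 2 ^ n * d ^ (1 / 2 : ℝ) := by
  cases n with
  | zero => simp; positivity
  | succ k =>
    have h := log_pow_le_factorial_mul_rpow k hd
    have h0 : 0 ≤ (k.factorial : ℝ) * 2 ^ k * d ^ (1 / 2 : ℝ) := by positivity
    simp only [Nat.add_sub_cancel, Nat.factorial_succ]
    push_cast
    have hk : (0 : ℝ) ≤ (k : ℝ) + 1 := by positivity
    have h1 := mul_le_mul_of_nonneg_left h hk
    have h2 := mul_nonneg hk h0
    rw [pow_succ]
    nlinarith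

theorem abs_stieltjesIncrement_le (n : ℕ) {i : ℕ} (hi : 1 ≤ i) :
    |stieltjesIncrement n i| ≤ n.factorial * 2 ^ (n + 1) * (i : ℝ) ^ (-(3 / 2) : ℝ) := by
  have hi1 : (1 : ℝ) ≤ i := by exact_mod_cast hi
  have hL : ∀ x : ℝ, (i : ℝ) ≤ x →
      HasDerivAt (fun t => Real.log t ^ (n + 1) / ((n : ℝ) + 1)) (Real.log x ^ n / x) x := by
    intro x hx
    have hx0 : x ≠ 0 := by linarith
    refine (((Real.hasDerivAt_log hx0).pow (n + 1)).div_const ((n : ℝ) + 1)).congr_deriv ?_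
    have : (n : ℝ) + 1 ≠ 0 := by positivity
    simp only [Nat.add_sub_cancel]
    push_cast
    field_simp
  have hf : ∀ x : ℝ, (i : ℝ) ≤ x → HasDerivAt (fun t => Real.log t ^ n / t)
      (((n : ℝ) * Real.log x ^ (n - 1) - Real.log x ^ n) / x ^ 2) x := by
    intro x hx
    have hx0 : x ≠ 0 := by linarith
    refine (((Real.hasDerivAt_log hx0).pow n).div (hasDerivAt_id x) hx0).congr_deriv ?_
    simp only [id, Pi.pow_apply]
    field_simp
  obtain ⟨c, hc, hceq⟩ := exists_hasDerivAt_eq_slope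
    (fun t => Real.log t ^ (n + 1) / ((n : ℝ) + 1)) (fun x => Real.log x ^ n / x)
    (by linarith : (i : ℝ) < (i : ℝ) + 1)
    (fun x hx => (hL x hx.1).continuousAt.continuousWithinAt) (fun x hx => hL x hx.1.le)
  obtain ⟨d, hd, hdeq⟩ := exists_hasDerivAt_eq_slope
    (fun t => Real.log t ^ n / t)
    (fun x => ((n : ℝ) * Real.log x ^ (n - 1) - Real.log x ^ n) / x ^ 2) hc.2
    (fun x hx => (hf x (hc.1.le.trans hx.1)).continuousAt.continuousWithinAt)
    (fun x hx => hf x (hc.1.le.trans hx.1.le))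
  have hid : (i : ℝ) ≤ d := hc.1.le.trans hd.1.le
  have hd1 : 1 ≤ d := hi1.trans hid
  have hd0 : 0 < d := by linarith
  have hlen : 0 < (i : ℝ) + 1 - c := by linarith [hc.2]
  rw [add_sub_cancel_left, div_one] at hceq
  rw [eq_div_iff hlen.ne'] at hdeq
  have hval : stieltjesIncrement n i =
      ((n : ℝ) * Real.log d ^ (n - 1) - Real.log d ^ n) / d ^ 2 * ((i : ℝ) + 1 - c) := by
    rw [hdeq, stieltjesIncrement, ← hceq]
  have hnum : |(n : ℝ) * Real.log d ^ (n - 1) - Real.log d ^ n| ≤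
      n.factorial * 2 ^ (n + 1) * d ^ (1 / 2 : ℝ) := by
    have h1 := natCast_mul_log_pow_pred_le n hd1
    have h2 := log_pow_le_factorial_mul_rpow n hd1
    have hlog := Real.log_nonneg hd1
    have h3 : 0 ≤ (n : ℝ) * Real.log d ^ (n - 1) := by positivity
    have h4 : 0 ≤ Real.log d ^ n := by positivity
    rw [pow_succ, abs_le]
    constructor <;> nlinarith
  have hpow : d ^ (1 / 2 : ℝ) / d ^ 2 = d ^ (-(3 / 2) : ℝ) := by
    rw [← Real.rpow_natCast d 2, ← Real.rpow_sub hd0]; norm_num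
  calc |stieltjesIncrement n i|
      = |(n : ℝ) * Real.log d ^ (n - 1) - Real.log d ^ n| / d ^ 2 * ((i : ℝ) + 1 - c) := by
        rw [hval, abs_mul, abs_div, abs_of_pos hlen, abs_of_pos (pow_pos hd0 2)]
    _ ≤ |(n : ℝ) * Real.log d ^ (n - 1) - Real.log d ^ n| / d ^ 2 :=
        mul_le_of_le_one_right (by positivity) (by linarith [hc.1])
    _ ≤ n.factorial * 2 ^ (n + 1) * d ^ (1 / 2 : ℝ) / d ^ 2 := by gcongr
    _ = n.factorial * 2 ^ (n + 1) * d ^ (-(3 / 2) : ℝ) := by rw [mul_div_assoc, hpow]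
    _ ≤ n.factorial * 2 ^ (n + 1) * (i : ℝ) ^ (-(3 / 2) : ℝ) := by
        exact mul_le_mul_of_nonneg_left
          (Real.rpow_le_rpow_of_nonpos (by linarith) hid (by norm_num)) (by positivity)

theorem abs_stieltjesIncrement_zero_le (n : ℕ) :
    |stieltjesIncrement n 0| ≤ n.factorial * 2 ^ (n + 1) := by
  have h1 : (1 : ℝ) ≤ n.factorial := by exact_mod_cast n.factorial_pos
  have h2 : (1 : ℝ) ≤ 2 ^ (n + 1) := one_le_pow₀ one_le_two
  have h3 : |stieltjesIncrement n 0| ≤ 1 := by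
    rcases n with _ | n <;> simp [stieltjesIncrement]
  nlinarith

/-- The Stieltjes constants satisfy `|γ_n| ≤ B n! 2^n` for a constant `B`. -/
theorem exists_abs_stieltjes_le :
    ∃ B : ℝ, 0 ≤ B ∧ ∀ n : ℕ, |stieltjes n| ≤ B * (n.factorial * 2 ^ n) := by
  set b : ℕ → ℝ := fun i => (if i = 0 then 1 else 0) + (i : ℝ) ^ (-(3 / 2) : ℝ)
  have hb : Summable b := by
    refine Summable.add (summable_of_ne_finset_zero (s := {0}) ?_)
      (Real.summable_nat_rpow.2 (by norm_num))
    intro i hi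
    simp_all
  have hb0 : ∀ i, 0 ≤ b i := fun i => by
    simp only [b]
    split_ifs <;> positivity
  refine ⟨2 * ∑' i, b i, mul_nonneg zero_le_two (tsum_nonneg hb0), fun n => ?_⟩
  have hle : ∀ i, ‖stieltjesIncrement n i‖ ≤ n.factorial * 2 ^ (n + 1) * b i := by
    intro i
    rcases Nat.eq_zero_or_pos i with rfl | hi
    · have hz : b 0 = 1 := by
        simp only [b]
        rw [Nat.cast_zero, Real.zero_rpow (by norm_num)]
        simp
      rw [hz, mul_one]
      exact abs_stieltjesIncrement_zero_le n
    · have hz : b i = (i : ℝ) ^ (-(3 / 2) : ℝ) := by simp [b, hi.ne']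
      rw [hz]
      exact abs_stieltjesIncrement_le n hi
  have hs := hb.mul_left ((n.factorial : ℝ) * 2 ^ (n + 1))
  have hlim := (hs.of_norm_bounded hle).hasSum.tendsto_sum_nat
  simp only [sum_stieltjesIncrement] at hlim
  have hγ : stieltjes n = ∑' i, stieltjesIncrement n i := hlim.limUnder_eq
  have hbound := tsum_of_norm_bounded hs.hasSum hle
  rw [tsum_mul_left, Real.norm_eq_abs, ← hγ] at hbound
  calc |stieltjes n| ≤ _ := hbound
    _ = _ := by rw [pow_succ]; ring

theorem exists_abs_ellZero_le : ∃ A : ℝ, ∀ j : ℕ, |ellZero j| ≤ A * 2 ^ j := by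
  obtain ⟨B, hB, h⟩ := exists_abs_stieltjes_le
  refine ⟨1 + 2 * B, fun j => ?_⟩
  have h1 : |∑ i ∈ Finset.range (j + 1), stieltjes i / (Nat.factorial i : ℝ)| ≤
      ∑ i ∈ Finset.range (j + 1), B * 2 ^ i := by
    refine (Finset.abs_sum_le_sum_abs _ _).trans (Finset.sum_le_sum fun i _ => ?_)
    have hpos : (0 : ℝ) < i.factorial := by exact_mod_cast i.factorial_pos
    rw [abs_div, abs_of_pos hpos, div_le_iff₀ hpos]
    linarith [h i]
  rw [← Finset.mul_sum, geom_sum_eq (by norm_num)] at h1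
  have h2 : (1 : ℝ) ≤ 2 ^ j := one_le_pow₀ one_le_two
  have h3 := abs_add_le (-1 : ℝ) (∑ i ∈ Finset.range (j + 1), stieltjes i / (Nat.factorial i : ℝ))
  rw [abs_neg, abs_one] at h3
  rw [pow_succ] at h1
  rw [ellZero]
  nlinarith

theorem summable_norm_ellZero_series (m : ℕ) (z : ℂ) :
    Summable (fun n : ℕ => ‖((ellZero (m + n) : ℝ) : ℂ) / (Nat.factorial n : ℂ) * z ^ n‖) := by
  obtain ⟨A, hA⟩ := exists_abs_ellZero_le
  refine Summable.of_nonneg_of_le (fun _ => norm_nonneg _) (fun n => ?_)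
    ((Real.summable_pow_div_factorial (2 * ‖z‖)).mul_left (A * 2 ^ m))
  have hpos : (0 : ℝ) < n.factorial := by exact_mod_cast n.factorial_pos
  rw [norm_mul, norm_div, norm_pow, Complex.norm_real, Complex.norm_natCast, Real.norm_eq_abs]
  calc |ellZero (m + n)| / n.factorial * ‖z‖ ^ n
      ≤ A * 2 ^ (m + n) / n.factorial * ‖z‖ ^ n := by gcongr; exact hA _
    _ = A * 2 ^ m * ((2 * ‖z‖) ^ n / n.factorial) := by rw [pow_add, mul_pow]; ring

/-- `ℓ_n^{(m)}` is the `n`-th finite difference of `k ↦ ℓ_0^{(m+k)}`. -/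
theorem ellGen_eq_sum_ellZero (n m : ℕ) :
    ellGen n m = ∑ k ∈ Finset.range (n + 1),
      (n.choose k : ℝ) * (-1 : ℝ) ^ (n - k) * ellZero (m + k) := by
  have h : ∑ k ∈ Finset.range (n + 1), (n.choose k : ℝ) * (-1 : ℝ) ^ (n - k) =
      if n = 0 then 1 else 0 := by
    have := add_pow (1 : ℝ) (-1) n
    simp only [one_pow, one_mul, add_neg_cancel, zero_pow_eq] at this
    rw [this]
    exact Finset.sum_congr rfl fun k _ => mul_comm _ _
  simp only [ellGen, ellZero, mul_add, Finset.sum_add_distrib, mul_neg_one, Finset.sum_neg_distrib,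
    h]

theorem ellGen_term_eq_sum_antidiagonal (n m : ℕ) (z : ℂ) :
    ((ellGen n m : ℝ) : ℂ) / (Nat.factorial n : ℂ) * z ^ n =
      ∑ kl ∈ Finset.HasAntidiagonal.antidiagonal n,
        (((ellZero (m + kl.1) : ℝ) : ℂ) / (Nat.factorial kl.1 : ℂ) * z ^ kl.1) *
          ((-z) ^ kl.2 / (Nat.factorial kl.2 : ℂ)) := by
  rw [Finset.Nat.sum_antidiagonal_eq_sum_range_succ_mk, ellGen_eq_sum_ellZero]
  push_cast
  rw [Finset.sum_div, Finset.sum_mul]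
  refine Finset.sum_congr rfl fun k hk => ?_
  have hkn : k ≤ n := Nat.lt_succ_iff.1 (Finset.mem_range.1 hk)
  have hz : z ^ n = z ^ k * z ^ (n - k) := by rw [← pow_add, Nat.add_sub_cancel' hkn]
  have h0 : ∀ j : ℕ, (j.factorial : ℂ) ≠ 0 := fun j => by exact_mod_cast j.factorial_ne_zero
  have := h0 n
  have := h0 k
  have := h0 (n - k)
  rw [Nat.cast_choose ℂ hkn, neg_pow z, hz]
  field_simp

theorem statement16 (m : ℕ) (z : ℂ) (hz : ‖z‖ < 1) :
    Summable (fun n : ℕ => ((ellGen n m : ℝ) : ℂ) / (Nat.factorial n : ℂ) * z ^ n) ∧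
    Summable (fun n : ℕ => ((ellZero (m + n) : ℝ) : ℂ) / (Nat.factorial n : ℂ) * z ^ n) ∧
    (∑' n : ℕ, ((ellGen n m : ℝ) : ℂ) / (Nat.factorial n : ℂ) * z ^ n) =
      (∑' n : ℕ, ((ellZero (m + n) : ℝ) : ℂ) / (Nat.factorial n : ℂ) * z ^ n) *
        Complex.exp (-z) := by
  have hG := summable_norm_ellZero_series m z
  have hE := NormedSpace.norm_expSeries_div_summable (𝔸 := ℂ) (-z)
  have hexp : Complex.exp (-z) = ∑' n : ℕ, (-z) ^ n / (Nat.factorial n : ℂ) := by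
    rw [Complex.exp_eq_exp_ℂ, NormedSpace.exp_eq_tsum_div]
  simp only [ellGen_term_eq_sum_antidiagonal]
  refine ⟨(summable_norm_sum_mul_antidiagonal_of_summable_norm hG hE).of_norm, hG.of_norm, ?_⟩
  rw [hexp, tsum_mul_tsum_eq_tsum_sum_antidiagonal_of_summable_norm hG hE]
end

section
/- For every nonnegative integer m and every complex number s = σ + it with σ > 1/2, one has ∑_{n=0}^{∞} C(n+m, n) · |ℓ_n^{(m)}| · |(1−s)/s|^n ≤ ‖{·}‖_{(m)} · ( |s| / √(2σ − 1) )^{m+1}, where ‖{·}‖_{(m)}² = (1/m!) ∫_{1}^{∞} {x}² (log x)^m / x² dx; in particular the series on the left converges. -/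
open Filter Finset MeasureTheory

theorem integrableOn_and_integral_log_pow_div_sq (p : ℕ) :
    IntegrableOn (fun x : ℝ => Real.log x ^ p / x ^ 2) (Set.Ioi 1) ∧
    ∫ x in Set.Ioi (1 : ℝ), Real.log x ^ p / x ^ 2 = (p.factorial : ℝ) := by
  have himg : Real.exp '' Set.Ioi 0 = Set.Ioi 1 := by
    ext y
    simp only [Set.mem_image, Set.mem_Ioi]
    constructor
    · rintro ⟨x, hx, rfl⟩
      exact Real.one_lt_exp_iff.mpr hx
    · intro hy
      exact ⟨Real.log y, Real.log_pos hy, Real.exp_log (by linarith)⟩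
  have hd : ∀ x ∈ Set.Ioi (0 : ℝ), HasDerivWithinAt Real.exp (Real.exp x) (Set.Ioi 0) x :=
    fun x _ => (Real.hasDerivAt_exp x).hasDerivWithinAt
  have hcongr : ∀ x ∈ Set.Ioi (0 : ℝ),
      Real.exp (-x) * x ^ (((p : ℝ) + 1) - 1) =
        |Real.exp x| • (Real.log (Real.exp x) ^ p / Real.exp x ^ 2) := by
    intro x _
    rw [Real.log_exp, abs_of_pos (Real.exp_pos x), add_sub_cancel_right, Real.rpow_natCast,
      Real.exp_neg, smul_eq_mul]
    have := Real.exp_pos x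
    field_simp
  have hp : (0 : ℝ) < (p : ℝ) + 1 := by positivity
  constructor
  · rw [← himg, integrableOn_image_iff_integrableOn_abs_deriv_smul measurableSet_Ioi hd
      Real.exp_injective.injOn]
    exact (Real.GammaIntegral_convergent hp).congr_fun hcongr measurableSet_Ioi
  · rw [← himg, integral_image_eq_integral_abs_deriv_smul measurableSet_Ioi hd
      Real.exp_injective.injOn, ← setIntegral_congr_fun measurableSet_Ioi hcongr,
      ← Real.Gamma_eq_integral hp, Real.Gamma_nat_eq_factorial]

theorem integrableOn_log_pow_div_sq (p : ℕ) :
    IntegrableOn (fun x : ℝ => Real.log x ^ p / x ^ 2) (Set.Ioi 1) :=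
  (integrableOn_and_integral_log_pow_div_sq p).1

theorem integral_log_pow_div_sq (p : ℕ) :
    ∫ x in Set.Ioi (1 : ℝ), Real.log x ^ p / x ^ 2 = (p.factorial : ℝ) :=
  (integrableOn_and_integral_log_pow_div_sq p).2

theorem sum_choose_neg_one_pow_factorial_div (n m j : ℕ) (hj : j ≤ n) :
    ∑ k ∈ range (n + 1), (n.choose k : ℝ) * (-1) ^ (n - k) *
      (((m + k + j).factorial : ℝ) / (m + k).factorial) = if j = n then (n.factorial : ℝ) else 0 := by
  have key : ∀ k, (((m + k + j).factorial : ℝ) / (m + k).factorial) =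
      (ascPochhammer ℝ j).eval (((m : ℝ) + 1) + k • (1 : ℝ)) := by
    intro k
    have h := Nat.factorial_mul_ascFactorial (m + k) j
    rw [← h, ← ascPochhammer_nat_eq_ascFactorial]
    push_cast [ascPochhammer_eval_cast]
    have : ((m + k).factorial : ℝ) ≠ 0 := by positivity
    rw [mul_div_cancel_left₀ _ this, nsmul_eq_mul]
    congr 1
    ring
  have hs := fwdDiff_iter_eq_sum_shift (1 : ℝ) (ascPochhammer ℝ j).eval n ((m : ℝ) + 1)
  have : ∑ k ∈ range (n + 1), (n.choose k : ℝ) * (-1) ^ (n - k) *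
      (((m + k + j).factorial : ℝ) / (m + k).factorial) =
      ((fwdDiff (1 : ℝ))^[n] (ascPochhammer ℝ j).eval) ((m : ℝ) + 1) := by
    rw [hs]
    refine sum_congr rfl fun k _ => ?_
    rw [key, zsmul_eq_mul]
    push_cast
    ring
  rw [this]
  split_ifs with h
  · subst h
    have := Polynomial.fwdDiff_iter_degree_eq_factorial (ascPochhammer ℝ j)
    rw [ascPochhammer_natDegree, (monic_ascPochhammer ℝ j).leadingCoeff] at this
    rw [this]
    simp
  · rw [Polynomial.fwdDiff_iter_eq_zero_of_degree_lt]
    · rfl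
    · rw [ascPochhammer_natDegree]; omega

/-- Bessel's inequality for a weighted orthogonal family of real functions. -/
theorem sum_sq_integral_div_le {α : Type*} [MeasurableSpace α] (μ : Measure α) (f w : α → ℝ)
    (φ : ℕ → α → ℝ) (d : ℕ → ℝ) (hw : 0 ≤ᵐ[μ] w) (hd : ∀ i, 0 < d i)
    (hff : Integrable (fun x => f x ^ 2 * w x) μ)
    (hfφ : ∀ i, Integrable (fun x => f x * φ i x * w x) μ)
    (hφφ : ∀ i j, Integrable (fun x => φ i x * φ j x * w x) μ)
    (horth : ∀ i j, ∫ x, φ i x * φ j x * w x ∂μ = if i = j then d i else 0) (N : ℕ) :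
    ∑ i ∈ range N, (∫ x, f x * φ i x * w x ∂μ) ^ 2 / d i ≤ ∫ x, f x ^ 2 * w x ∂μ := by
  set b : ℕ → ℝ := fun i => ∫ x, f x * φ i x * w x ∂μ with hb
  set a : ℕ → ℝ := fun i => b i / d i with ha
  have hexp : ∀ x, (f x - ∑ i ∈ range N, a i * φ i x) ^ 2 * w x =
      f x ^ 2 * w x - ∑ i ∈ range N, 2 * a i * (f x * φ i x * w x) +
        ∑ i ∈ range N, ∑ j ∈ range N, a i * a j * (φ i x * φ j x * w x) := by
    intro x
    have h1 : ∑ i ∈ range N, 2 * a i * (f x * φ i x * w x) =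
        2 * f x * (∑ i ∈ range N, a i * φ i x) * w x := by
      rw [mul_sum, sum_mul]
      exact sum_congr rfl fun i _ => by ring
    have h2 : ∑ i ∈ range N, ∑ j ∈ range N, a i * a j * (φ i x * φ j x * w x) =
        (∑ i ∈ range N, a i * φ i x) * (∑ i ∈ range N, a i * φ i x) * w x := by
      rw [sum_mul_sum, sum_mul]
      refine sum_congr rfl fun i _ => ?_
      rw [sum_mul]
      exact sum_congr rfl fun j _ => by ring
    rw [h1, h2]
    ring
  have hI1 : Integrable (fun x => ∑ i ∈ range N, 2 * a i * (f x * φ i x * w x)) μ :=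
    integrable_finsetSum _ fun i _ => (hfφ i).const_mul _
  have hI2 : Integrable
      (fun x => ∑ i ∈ range N, ∑ j ∈ range N, a i * a j * (φ i x * φ j x * w x)) μ :=
    integrable_finsetSum _ fun i _ => integrable_finsetSum _ fun j _ => (hφφ i j).const_mul _
  have hI3 : Integrable
      (fun x => f x ^ 2 * w x - ∑ i ∈ range N, 2 * a i * (f x * φ i x * w x)) μ := hff.sub hI1
  have hnonneg : 0 ≤ ∫ x, (f x - ∑ i ∈ range N, a i * φ i x) ^ 2 * w x ∂μ := by
    refine integral_nonneg_of_ae ?_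
    filter_upwards [hw] with x hx
    exact mul_nonneg (sq_nonneg _) hx
  simp_rw [hexp] at hnonneg
  rw [integral_add hI3 hI2, integral_sub hff hI1,
    integral_finsetSum _ fun i _ => (hfφ i).const_mul _,
    integral_finsetSum _ fun i _ => integrable_finsetSum _ fun j _ => (hφφ i j).const_mul _]
    at hnonneg
  have h2 : ∀ i ∈ range N, ∫ x, ∑ j ∈ range N, a i * a j * (φ i x * φ j x * w x) ∂μ =
      b i ^ 2 / d i := by
    intro i hi
    rw [integral_finsetSum _ fun j _ => (hφφ i j).const_mul _]
    simp_rw [integral_const_mul, horth]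
    simp only [mul_ite, mul_zero, sum_ite_eq, hi, if_true, ha]
    have := (hd i).ne'
    field_simp
  have h1 : ∀ i ∈ range N, ∫ x, 2 * a i * (f x * φ i x * w x) ∂μ = 2 * (b i ^ 2 / d i) := by
    intro i _
    rw [integral_const_mul]
    simp only [ha, hb]
    ring
  rw [sum_congr rfl h1, sum_congr rfl h2, ← mul_sum] at hnonneg
  linarith

theorem integrableOn_fract_mul {g : ℝ → ℝ} {s : Set ℝ} (hg : IntegrableOn g s) :
    IntegrableOn (fun x => Int.fract x * g x) s := by
  refine Integrable.bdd_mul hg (c := 1) measurable_fract.aestronglyMeasurable ?_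
  filter_upwards with x
  rw [Real.norm_eq_abs, abs_of_nonneg (Int.fract_nonneg x)]
  exact (Int.fract_lt_one x).le

/-- The derivative of `log x ^ n / x`. -/
noncomputable def logPowDivDeriv (n : ℕ) (x : ℝ) : ℝ :=
  n * (Real.log x ^ (n - 1) / x ^ 2) - Real.log x ^ n / x ^ 2

theorem integral_fract_mul_logPowDivDeriv_step (n N : ℕ) (hN : 1 ≤ N) :
    ∫ x in (N : ℝ)..((N + 1 : ℕ) : ℝ), Int.fract x * logPowDivDeriv n x =
      Real.log ((N : ℝ) + 1) ^ n / ((N : ℝ) + 1) -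
        (Real.log ((N : ℝ) + 1) ^ (n + 1) / ((n : ℝ) + 1) -
          Real.log (N : ℝ) ^ (n + 1) / ((n : ℝ) + 1)) := by
  have hN' : (1 : ℝ) ≤ N := by exact_mod_cast hN
  have hle : (N : ℝ) ≤ ((N + 1 : ℕ) : ℝ) := by push_cast; linarith
  have hcongr : ∫ x in (N : ℝ)..((N + 1 : ℕ) : ℝ), Int.fract x * logPowDivDeriv n x =
      ∫ x in (N : ℝ)..((N + 1 : ℕ) : ℝ), (x - N) * logPowDivDeriv n x := by
    rw [intervalIntegral.integral_of_le hle, intervalIntegral.integral_of_le hle,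
      integral_Ioc_eq_integral_Ioo, integral_Ioc_eq_integral_Ioo]
    refine setIntegral_congr_fun measurableSet_Ioo fun x hx => ?_
    have : ⌊x⌋ = (N : ℤ) := by
      rw [Int.floor_eq_iff]
      have h1 := hx.1
      have h2 := hx.2
      push_cast at h2 ⊢
      exact ⟨h1.le, h2⟩
    simp [Int.fract, this]
  have hpos : ∀ x ∈ Set.uIcc (N : ℝ) ((N + 1 : ℕ) : ℝ), 0 < x := by
    intro x hx
    rw [Set.uIcc_of_le hle] at hx
    linarith [hx.1]
  have hderiv : ∀ x ∈ Set.uIcc (N : ℝ) ((N + 1 : ℕ) : ℝ), HasDerivAt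
      (fun x : ℝ => (x - N) * (Real.log x ^ n / x) - Real.log x ^ (n + 1) / ((n : ℝ) + 1))
      ((x - N) * logPowDivDeriv n x) x := by
    intro x hx
    have hx0 := (hpos x hx).ne'
    have hl := Real.hasDerivAt_log hx0
    have h := (((hasDerivAt_id x).sub_const (N : ℝ)).mul
      ((hl.pow n).div (hasDerivAt_id x) hx0)).sub ((hl.pow (n + 1)).div_const ((n : ℝ) + 1))
    refine h.congr_deriv ?_
    have hn : (n : ℝ) + 1 ≠ 0 := by positivity
    simp only [logPowDivDeriv, id, Pi.pow_apply, Nat.add_sub_cancel, Pi.div_apply]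
    push_cast
    field_simp
    ring
  have hcont : ContinuousOn (fun x : ℝ => (x - N) * logPowDivDeriv n x)
      (Set.uIcc (N : ℝ) ((N + 1 : ℕ) : ℝ)) := by
    have hlog : ContinuousOn Real.log (Set.uIcc (N : ℝ) ((N + 1 : ℕ) : ℝ)) :=
      Real.continuousOn_log.mono fun x hx => (hpos x hx).ne'
    unfold logPowDivDeriv
    have h2 : ∀ x ∈ Set.uIcc (N : ℝ) ((N + 1 : ℕ) : ℝ), x ^ 2 ≠ 0 :=
      fun x hx => pow_ne_zero _ (hpos x hx).ne'
    fun_prop (disch := assumption)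
  rw [hcongr, intervalIntegral.integral_eq_sub_of_hasDerivAt hderiv hcont.intervalIntegrable]
  push_cast
  ring

theorem integrableOn_logPowDivDeriv (n : ℕ) : IntegrableOn (logPowDivDeriv n) (Set.Ioi 1) :=
  ((integrableOn_log_pow_div_sq (n - 1)).const_mul _).sub (integrableOn_log_pow_div_sq n)

theorem sum_log_pow_div_sub (n N : ℕ) :
    (∑ k ∈ range (N + 1), Real.log ((k : ℝ) + 1) ^ n / ((k : ℝ) + 1)) -
      Real.log ((N + 1 : ℕ) : ℝ) ^ (n + 1) / ((n : ℝ) + 1) =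
    (0 : ℝ) ^ n + ∫ x in (1 : ℝ)..((N + 1 : ℕ) : ℝ), Int.fract x * logPowDivDeriv n x := by
  have hint : ∀ a b : ℝ, 1 ≤ a → a ≤ b →
      IntervalIntegrable (fun x => Int.fract x * logPowDivDeriv n x) volume a b := by
    intro a b ha hab
    rw [intervalIntegrable_iff_integrableOn_Ioc_of_le hab]
    exact (integrableOn_fract_mul (integrableOn_logPowDivDeriv n)).mono_set
      fun x hx => lt_of_le_of_lt ha hx.1
  induction N with
  | zero => simp
  | succ N ih =>
    have h1 : (1 : ℝ) ≤ ((N + 1 : ℕ) : ℝ) := by push_cast; linarith [N.cast_nonneg (α := ℝ)]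
    have h2 : ((N + 1 : ℕ) : ℝ) ≤ ((N + 1 + 1 : ℕ) : ℝ) := by push_cast; linarith
    rw [← intervalIntegral.integral_add_adjacent_intervals (hint _ _ le_rfl h1) (hint _ _ h1 h2),
      integral_fract_mul_logPowDivDeriv_step n (N + 1) (by omega), sum_range_succ,
      ← add_assoc, ← ih]
    push_cast
    ring

theorem stieltjes_eq_integral (n : ℕ) :
    stieltjes n = (0 : ℝ) ^ n + ∫ x in Set.Ioi (1 : ℝ), Int.fract x * logPowDivDeriv n x := by
  refine Tendsto.limUnder_eq ?_
  rw [← tendsto_add_atTop_iff_nat 1]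
  simp_rw [sum_log_pow_div_sub]
  refine Tendsto.const_add _ (intervalIntegral_tendsto_integral_Ioi 1
    (integrableOn_fract_mul (integrableOn_logPowDivDeriv n)) ?_)
  exact tendsto_natCast_atTop_atTop.comp (tendsto_add_atTop_nat 1)

/-- The normalised logarithmic moments of the fractional part. -/
noncomputable def fractMoment (p : ℕ) : ℝ :=
  ∫ x in Set.Ioi (1 : ℝ), Int.fract x * (Real.log x ^ p / x ^ 2)

theorem stieltjes_zero_eq : stieltjes 0 = 1 - fractMoment 0 := by
  rw [stieltjes_eq_integral, fractMoment]
  simp [logPowDivDeriv, integral_neg, sub_eq_add_neg]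

theorem stieltjes_succ_eq (n : ℕ) :
    stieltjes (n + 1) = (n + 1) * fractMoment n - fractMoment (n + 1) := by
  rw [stieltjes_eq_integral, fractMoment, fractMoment, ← integral_const_mul, ← integral_sub
    ((integrableOn_fract_mul (integrableOn_log_pow_div_sq n)).const_mul _)
    (integrableOn_fract_mul (integrableOn_log_pow_div_sq (n + 1))), zero_pow n.succ_ne_zero,
    zero_add]
  refine integral_congr_ae (Eventually.of_forall fun x => ?_)
  simp only [logPowDivDeriv, Nat.add_sub_cancel]
  push_cast
  ring

theorem sum_stieltjes_div_factorial (p : ℕ) :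
    ∑ j ∈ range (p + 1), stieltjes j / (j.factorial : ℝ) =
      1 - fractMoment p / (p.factorial : ℝ) := by
  induction p with
  | zero => simp [stieltjes_zero_eq]
  | succ p ih =>
    rw [sum_range_succ, ih, stieltjes_succ_eq, Nat.factorial_succ]
    have : (p.factorial : ℝ) ≠ 0 := by positivity
    have : (p : ℝ) + 1 ≠ 0 := by positivity
    push_cast
    field_simp
    ring

/-- The Laguerre polynomial `L_n^{(m)}` in the variable `log x`, up to normalisation. -/
noncomputable def logLaguerre (m n : ℕ) (x : ℝ) : ℝ :=
  ∑ k ∈ range (n + 1), (n.choose k : ℝ) * (-1) ^ (n - k) / ((m + k).factorial : ℝ) * Real.log x ^ k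

theorem logLaguerre_mul_pow_eq (m n j : ℕ) (x : ℝ) :
    logLaguerre m n x * Real.log x ^ j * (Real.log x ^ m / x ^ 2) =
      ∑ k ∈ range (n + 1), (n.choose k : ℝ) * (-1) ^ (n - k) / ((m + k).factorial : ℝ) *
        (Real.log x ^ (m + k + j) / x ^ 2) := by
  rw [logLaguerre, sum_mul, sum_mul]
  refine sum_congr rfl fun k _ => ?_
  rw [pow_add, pow_add]
  ring

theorem integrableOn_logLaguerre_mul_pow (m n j : ℕ) :
    IntegrableOn (fun x => logLaguerre m n x * Real.log x ^ j * (Real.log x ^ m / x ^ 2))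
      (Set.Ioi 1) := by
  simp_rw [logLaguerre_mul_pow_eq]
  exact integrable_finsetSum _ fun k _ => (integrableOn_log_pow_div_sq _).const_mul _

theorem integral_logLaguerre_mul_pow (m n j : ℕ) (hj : j ≤ n) :
    ∫ x in Set.Ioi (1 : ℝ), logLaguerre m n x * Real.log x ^ j * (Real.log x ^ m / x ^ 2) =
      if j = n then (n.factorial : ℝ) else 0 := by
  simp_rw [logLaguerre_mul_pow_eq]
  rw [integral_finsetSum _ fun k _ => (integrableOn_log_pow_div_sq _).const_mul _,
    ← sum_choose_neg_one_pow_factorial_div n m j hj]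
  refine sum_congr rfl fun k _ => ?_
  rw [integral_const_mul, integral_log_pow_div_sq]
  ring

theorem logLaguerre_mul_logLaguerre_eq (m n j : ℕ) (x : ℝ) :
    logLaguerre m n x * logLaguerre m j x * (Real.log x ^ m / x ^ 2) =
      ∑ k ∈ range (j + 1), (j.choose k : ℝ) * (-1) ^ (j - k) / ((m + k).factorial : ℝ) *
        (logLaguerre m n x * Real.log x ^ k * (Real.log x ^ m / x ^ 2)) := by
  conv_lhs => rw [logLaguerre.eq_def m j, mul_sum, sum_mul]
  exact sum_congr rfl fun k _ => by ring

theorem integrableOn_logLaguerre_mul_logLaguerre (m n j : ℕ) :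
    IntegrableOn (fun x => logLaguerre m n x * logLaguerre m j x * (Real.log x ^ m / x ^ 2))
      (Set.Ioi 1) := by
  simp_rw [logLaguerre_mul_logLaguerre_eq]
  exact integrable_finsetSum _ fun k _ => (integrableOn_logLaguerre_mul_pow m n k).const_mul _

theorem integral_logLaguerre_mul_logLaguerre_of_le (m n j : ℕ) (hj : j ≤ n) :
    ∫ x in Set.Ioi (1 : ℝ), logLaguerre m n x * logLaguerre m j x * (Real.log x ^ m / x ^ 2) =
      if n = j then (n.factorial : ℝ) / (n + m).factorial else 0 := by
  simp_rw [logLaguerre_mul_logLaguerre_eq]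
  rw [integral_finsetSum _ fun k _ => (integrableOn_logLaguerre_mul_pow m n k).const_mul _]
  have h : ∀ k ∈ range (j + 1), ∫ x in Set.Ioi (1 : ℝ),
      (j.choose k : ℝ) * (-1) ^ (j - k) / ((m + k).factorial : ℝ) *
        (logLaguerre m n x * Real.log x ^ k * (Real.log x ^ m / x ^ 2)) =
      if k = n then (j.choose k : ℝ) * (-1) ^ (j - k) / ((m + k).factorial : ℝ) * n.factorial
        else 0 := by
    intro k hk
    rw [integral_const_mul, integral_logLaguerre_mul_pow m n k (by rw [mem_range] at hk; omega),
      mul_ite, mul_zero]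
  rw [sum_congr rfl h, sum_ite_eq']
  by_cases hnj : n = j
  · subst hnj
    simp only [mem_range, Nat.lt_succ_self, if_true, Nat.choose_self, Nat.sub_self, pow_zero,
      Nat.cast_one, add_comm m n]
    ring
  · rw [if_neg hnj, if_neg (by rw [mem_range]; omega)]

theorem integral_logLaguerre_mul_logLaguerre (m n j : ℕ) :
    ∫ x in Set.Ioi (1 : ℝ), logLaguerre m n x * logLaguerre m j x * (Real.log x ^ m / x ^ 2) =
      if n = j then (n.factorial : ℝ) / (n + m).factorial else 0 := by
  rcases le_total j n with h | h
  · exact integral_logLaguerre_mul_logLaguerre_of_le m n j h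
  · simp_rw [mul_comm (logLaguerre m n _)]
    rw [integral_logLaguerre_mul_logLaguerre_of_le m j n h]
    by_cases hnj : n = j
    · subst hnj; rfl
    · rw [if_neg hnj, if_neg (Ne.symm hnj)]

theorem integrableOn_fract_mul_logLaguerre (m n : ℕ) :
    IntegrableOn (fun x => Int.fract x * logLaguerre m n x * (Real.log x ^ m / x ^ 2))
      (Set.Ioi 1) := by
  simpa [mul_assoc] using integrableOn_fract_mul (integrableOn_logLaguerre_mul_pow m n 0)

theorem ellGen_eq_neg_integral (n m : ℕ) :
    ellGen n m = -∫ x in Set.Ioi (1 : ℝ),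
      Int.fract x * logLaguerre m n x * (Real.log x ^ m / x ^ 2) := by
  have hint : ∫ x in Set.Ioi (1 : ℝ),
      Int.fract x * logLaguerre m n x * (Real.log x ^ m / x ^ 2) =
      ∑ k ∈ range (n + 1), (n.choose k : ℝ) * (-1) ^ (n - k) *
        (fractMoment (m + k) / ((m + k).factorial : ℝ)) := by
    have hexp : ∀ x : ℝ, Int.fract x * logLaguerre m n x * (Real.log x ^ m / x ^ 2) =
        ∑ k ∈ range (n + 1), (n.choose k : ℝ) * (-1) ^ (n - k) / ((m + k).factorial : ℝ) *
          (Int.fract x * (Real.log x ^ (m + k) / x ^ 2)) := by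
      intro x
      rw [logLaguerre, mul_sum, sum_mul]
      refine sum_congr rfl fun k _ => ?_
      rw [pow_add]
      ring
    simp_rw [hexp]
    rw [integral_finsetSum _ fun k _ =>
      (integrableOn_fract_mul (integrableOn_log_pow_div_sq _)).const_mul _]
    refine sum_congr rfl fun k _ => ?_
    rw [integral_const_mul, fractMoment]
    ring
  have hdelta : ∑ k ∈ range (n + 1), (n.choose k : ℝ) * (-1) ^ (n - k) =
      if n = 0 then (1 : ℝ) else 0 := by
    have h := sum_choose_neg_one_pow_factorial_div n 0 0 n.zero_le
    have h1 : ∀ k, (((0 + k + 0).factorial : ℝ) / (0 + k).factorial) = 1 :=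
      fun k => div_self (by positivity)
    simp only [h1, mul_one] at h
    rw [h]
    by_cases hn : n = 0
    · simp [hn]
    · rw [if_neg hn, if_neg (Ne.symm hn)]
  rw [hint, ellGen, ← hdelta]
  simp_rw [sum_stieltjes_div_factorial, mul_sub, mul_one, sum_sub_distrib]
  ring

theorem sum_choose_mul_ellGen_sq_le (m N : ℕ) :
    ∑ n ∈ range N, ((n + m).choose n : ℝ) * |ellGen n m| ^ 2 ≤
      (1 / (m.factorial : ℝ)) *
        ∫ x in Set.Ioi (1 : ℝ), Int.fract x ^ 2 * Real.log x ^ m / x ^ 2 := by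
  have hff : IntegrableOn (fun x : ℝ => Int.fract x ^ 2 * (Real.log x ^ m / x ^ 2))
      (Set.Ioi 1) := by
    simpa [sq, mul_assoc] using
      integrableOn_fract_mul (integrableOn_fract_mul (integrableOn_log_pow_div_sq m))
  have hw : 0 ≤ᵐ[volume.restrict (Set.Ioi 1)] fun x : ℝ => Real.log x ^ m / x ^ 2 := by
    filter_upwards [ae_restrict_mem measurableSet_Ioi] with x hx
    have := Real.log_nonneg (le_of_lt hx)
    simp only [Pi.zero_apply]
    positivity
  have h := sum_sq_integral_div_le (volume.restrict (Set.Ioi (1 : ℝ))) Int.fract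
    (fun x => Real.log x ^ m / x ^ 2) (logLaguerre m)
    (fun n => (n.factorial : ℝ) / (n + m).factorial) hw (fun n => by positivity) hff
    (integrableOn_fract_mul_logLaguerre m) (integrableOn_logLaguerre_mul_logLaguerre m)
    (integral_logLaguerre_mul_logLaguerre m) N
  simp_rw [mul_div_assoc]
  refine le_trans (le_of_eq ?_) (mul_le_mul_of_nonneg_left h (by positivity))
  rw [mul_sum]
  refine sum_congr rfl fun n _ => ?_
  rw [ellGen_eq_neg_integral, abs_neg, sq_abs, Nat.cast_add_choose]
  field_simp

theorem one_sub_norm_one_sub_div_sq {s : ℂ} (hs : s ≠ 0) :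
    1 - (‖(1 - s) / s‖ ^ 2) = (2 * s.re - 1) / ‖s‖ ^ 2 := by
  have h : ‖s‖ ^ 2 ≠ 0 := by positivity
  have h1 : ‖1 - s‖ ^ 2 = 1 - 2 * s.re + ‖s‖ ^ 2 := by
    rw [Complex.sq_norm, Complex.sq_norm, Complex.normSq_apply, Complex.normSq_apply]
    simp
    ring
  rw [norm_div, div_pow, h1]
  field_simp
  ring

theorem statement17 (m : ℕ) (s : ℂ) (hs : 1 / 2 < s.re) :
    Summable (fun n : ℕ =>
      ((n + m).choose n : ℝ) * |ellGen n m| * ‖(1 - s) / s‖ ^ n) ∧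
    (∑' n : ℕ, ((n + m).choose n : ℝ) * |ellGen n m| * ‖(1 - s) / s‖ ^ n) ≤
      Real.sqrt ((1 / (Nat.factorial m : ℝ)) *
          ∫ x in Set.Ioi (1 : ℝ), Int.fract x ^ 2 * Real.log x ^ m / x ^ 2) *
        (‖s‖ / Real.sqrt (2 * s.re - 1)) ^ (m + 1) := by
  have hs0 : s ≠ 0 := by
    rintro rfl
    norm_num at hs
  have hsn : 0 < ‖s‖ := norm_pos_iff.mpr hs0
  have hσ : 0 < 2 * s.re - 1 := by linarith
  set r := ‖(1 - s) / s‖ with hr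
  have hr0 : 0 ≤ r := norm_nonneg _
  have h1r : 1 - r ^ 2 = (2 * s.re - 1) / ‖s‖ ^ 2 := one_sub_norm_one_sub_div_sq hs0
  have hr1 : ‖r ^ 2‖ < 1 := by
    rw [Real.norm_of_nonneg (sq_nonneg r)]
    have : 0 < 1 - r ^ 2 := by rw [h1r]; positivity
    linarith
  have hgeom := hasSum_choose_mul_geometric_of_norm_lt_one m hr1
  have hgeom_eq : Real.sqrt (1 / (1 - r ^ 2) ^ (m + 1)) =
      (‖s‖ / Real.sqrt (2 * s.re - 1)) ^ (m + 1) := by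
    have : 1 / (1 - r ^ 2) ^ (m + 1) = ((‖s‖ / Real.sqrt (2 * s.re - 1)) ^ (m + 1)) ^ 2 := by
      rw [← pow_mul, mul_comm (m + 1), pow_mul, div_pow, Real.sq_sqrt hσ.le, h1r, ← one_div_pow,
        one_div_div]
    rw [this, Real.sqrt_sq (by positivity)]
  have hterm : ∀ n : ℕ, 0 ≤ ((n + m).choose n : ℝ) * |ellGen n m| * r ^ n :=
    fun n => by positivity
  have hpartial : ∀ N, ∑ n ∈ range N, ((n + m).choose n : ℝ) * |ellGen n m| * r ^ n ≤
      Real.sqrt ((1 / (Nat.factorial m : ℝ)) *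
          ∫ x in Set.Ioi (1 : ℝ), Int.fract x ^ 2 * Real.log x ^ m / x ^ 2) *
        (‖s‖ / Real.sqrt (2 * s.re - 1)) ^ (m + 1) := by
    intro N
    have hcs := Real.sum_mul_le_sqrt_mul_sqrt (range N)
      (fun n => Real.sqrt ((n + m).choose n) * |ellGen n m|)
      (fun n => Real.sqrt ((n + m).choose n) * r ^ n)
    have hc : ∀ n : ℕ, Real.sqrt ((n + m).choose n : ℝ) ^ 2 = ((n + m).choose n : ℝ) :=
      fun n => Real.sq_sqrt (Nat.cast_nonneg _)
    have hprod : ∀ n : ℕ, Real.sqrt ((n + m).choose n : ℝ) * |ellGen n m| *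
        (Real.sqrt ((n + m).choose n : ℝ) * r ^ n) =
        ((n + m).choose n : ℝ) * |ellGen n m| * r ^ n := by
      intro n
      rw [← hc n, Real.sqrt_sq (Real.sqrt_nonneg _)]
      ring
    simp only [hprod, mul_pow, hc] at hcs
    refine hcs.trans (mul_le_mul (Real.sqrt_le_sqrt (sum_choose_mul_ellGen_sq_le m N)) ?_
      (Real.sqrt_nonneg _) (Real.sqrt_nonneg _))
    rw [← hgeom_eq]
    refine Real.sqrt_le_sqrt ?_
    have hle := sum_le_hasSum (range N) (fun n _ => by positivity) hgeom
    refine le_trans (le_of_eq (sum_congr rfl fun n _ => ?_)) hle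
    rw [Nat.choose_symm_add, ← pow_mul, ← pow_mul, mul_comm n 2]
  exact ⟨summable_of_sum_range_le hterm hpartial, Real.tsum_le_of_sum_range_le hterm hpartial⟩
end
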